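/- For n ≥ 3, the monoid M_n is finite, and its cardinality equals the number of triples (r, s, β) where r and s are equivalence relations on the set {1, …, n} and β is a bijection from the quotient set {1, …, n}/r to the quotient set {1, …, n}/s. -/

import Mathlib

/-! Words over the alphabet `{x, s₁, …, s_{n-1}}` of the presentation of the dual
symmetric inverse monoid, encoded as `FreeMonoid (Fin n)` with letter `0 = x` and
letter `i = sᵢ` for `1 ≤ i ≤ n - 1`. -/

/-- The letter `x`. -/
def xw (n : ℕ) : FreeMonoid (Fin n) :=
  if h : 0 < n then FreeMonoid.of ⟨0, h⟩ else 1

/-- The letter `sᵢ` (for `1 ≤ i ≤ n - 1`; junk value `1` otherwise). -/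
def sw (n : ℕ) (i : ℕ) : FreeMonoid (Fin n) :=
  if h : i < n then FreeMonoid.of ⟨i, h⟩ else 1

/-- The word `σ = s₂ s₃ s₁ s₂`. -/
def σw (n : ℕ) : FreeMonoid (Fin n) := sw n 2 * sw n 3 * sw n 1 * sw n 2

/-- The exponent `m_{ij}`: `1` if `i = j`, `3` if `|i - j| = 1`, and `2` if
`|i - j| > 1`. -/
def mExp (i j : ℕ) : ℕ :=
  if i = j then 1 else if j - i = 1 ∨ i - j = 1 then 3 else 2

/-- The words `l₂ = x s₂ s₁` and `l_{i+1} = s_{i+1} lᵢ s_{i+1} sᵢ` (junk value `1`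
for `i < 2`). -/
def lw (n : ℕ) : ℕ → FreeMonoid (Fin n)
  | 0 => 1
  | 1 => 1
  | 2 => xw n * sw n 2 * sw n 1
  | (i + 3) => sw n (i + 3) * lw n (i + 2) * sw n (i + 3) * sw n (i + 2)

/-- The words `y₃ = x` and `y_{i+1} = lᵢ yᵢ sᵢ` (junk value `1` for `i < 3`). -/
def yw (n : ℕ) : ℕ → FreeMonoid (Fin n)
  | 0 => 1
  | 1 => 1
  | 2 => 1
  | 3 => xw n
  | (i + 4) => lw n (i + 3) * yw n (i + 3) * sw n (i + 3)

/-- The defining relations (R1)–(R7) of the monoid `Mₙ`.  Any relation involving a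
generator `sᵢ` with `i > n - 1` is omitted (this is the role of the hypotheses
bounding the indices, and of `4 ≤ n` in (R5), which involves `s₃`). -/
inductive MRel (n : ℕ) : FreeMonoid (Fin n) → FreeMonoid (Fin n) → Prop
  | r1 {i j : ℕ} : 1 ≤ i → i ≤ j → j ≤ n - 1 →
      MRel n ((sw n i * sw n j) ^ mExp i j) 1
  | r2 : MRel n (xw n ^ 3) (xw n)
  | r3a : MRel n (xw n * sw n 1) (xw n)
  | r3b : MRel n (sw n 1 * xw n) (xw n)
  | r4a : MRel n (xw n * sw n 2 * xw n) (xw n * sw n 2 * xw n * sw n 2)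
  | r4b : MRel n (xw n * sw n 2 * xw n) (sw n 2 * xw n * sw n 2 * xw n)
  | r4c : MRel n (xw n * sw n 2 * xw n) (xw n * sw n 2 * xw n ^ 2)
  | r4d : MRel n (xw n * sw n 2 * xw n) (xw n ^ 2 * sw n 2 * xw n)
  | r5a : 4 ≤ n →
      MRel n (xw n ^ 2 * σw n * xw n ^ 2 * σw n) (σw n * xw n ^ 2 * σw n * xw n ^ 2)
  | r5b : 4 ≤ n →
      MRel n (xw n ^ 2 * σw n * xw n ^ 2 * σw n) (xw n * sw n 2 * sw n 3 * sw n 2 * xw n)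
  | r6 {i : ℕ} : 3 ≤ i → i ≤ n - 1 →
      MRel n (yw n i * sw n i * yw n i) (sw n i * yw n i * sw n i)
  | r7 {i : ℕ} : 4 ≤ i → i ≤ n - 1 →
      MRel n (xw n * sw n i) (sw n i * xw n)

/-- The monoid congruence generated by the relations (R1)–(R7). -/
def Mcon (n : ℕ) : Con (FreeMonoid (Fin n)) := conGen (MRel n)

/-- The monoid `Mₙ` presented by generators `x, s₁, …, s_{n-1}` and relations
(R1)–(R7). -/
abbrev M (n : ℕ) := (Mcon n).Quotient

/-- The generator `x` of `Mₙ`. -/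
def xm (n : ℕ) : M n := (Mcon n).mk' (xw n)

/-- The generator `sᵢ` of `Mₙ`. -/
def sm (n : ℕ) (i : ℕ) : M n := (Mcon n).mk' (sw n i)

/-- The element `σ = s₂ s₃ s₁ s₂` of `Mₙ`. -/
def σm (n : ℕ) : M n := (Mcon n).mk' (σw n)

/-- Elements `ρ π`, `e a b` and `z a b c` of a monoid that behave like the permutations, the
idempotents merging `a` and `b`, and the moves of a point `b` from the block of `a` to the block
of `c`, in the monoid of block bijections of `X`. -/
structure MoveSystem (X N : Type*) [DecidableEq X] [Monoid N] where
  ρ : Equiv.Perm X →* N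
  e : X → X → N
  z : X → X → X → N
  e_self (a : X) : e a a = 1
  e_symm (a b : X) : e a b = e b a
  e_conj (π : Equiv.Perm X) (a b : X) : ρ π * e a b = e (π a) (π b) * ρ π
  z_conj (π : Equiv.Perm X) (a b c : X) : ρ π * z a b c = z (π a) (π b) (π c) * ρ π
  e_idem (a b : X) : e a b * e a b = e a b
  e_swap (a b : X) : e a b * ρ (Equiv.swap a b) = e a b
  e_comm_disjoint {a b c d : X} : [a, b, c, d].Nodup → e a b * e c d = e c d * e a b
  e_comm_adjacent {a b c : X} : [a, b, c].Nodup → e a b * e b c = e b c * e a b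
  e_trans {a b c : X} : [a, b, c].Nodup → e a b * e b c * e a c = e a b * e b c
  e_mul_z {a b c : X} : [a, b, c].Nodup → e a b * z a b c = z a b c
  z_mul_e {a b c : X} : [a, b, c].Nodup → z a b c * e b c = z a b c
  z_mul_z {a b c : X} : [a, b, c].Nodup → z a b c * z c b a = e a b
  e_mul_e_mul_z {a b c : X} : [a, b, c].Nodup → e a b * e a c * z a b c = e a b * e a c
  z_comm_e_ends {a b c : X} : [a, b, c].Nodup → e a c * z a b c = z a b c * e a c
  z_mul_z_triangle {a b c d : X} : [a, b, c, d].Nodup → z a b c * z c b d = z a b d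
  z_mul_z_swap {a b c d : X} : [a, b, c, d].Nodup →
    z a b c * z c d a = e a b * e c d * ρ (Equiv.swap b d)

namespace MoveSystem

open Function

section Algebra

variable {X N : Type*} [DecidableEq X] [Monoid N] (S : MoveSystem X N)

theorem e_comm (a b c d : X) : S.e a b * S.e c d = S.e c d * S.e a b := by
  by_cases hab : a = b
  · simp [hab, S.e_self]
  by_cases hcd : c = d
  · simp [hcd, S.e_self]
  by_cases hac : a = c
  · subst hac
    by_cases hbd : b = d
    · rw [hbd]
    · rw [S.e_symm a b]
      exact S.e_comm_adjacent (by simp; tauto)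
  by_cases had : a = d
  · subst had
    by_cases hbc : b = c
    · rw [hbc, S.e_symm c a]
    · rw [S.e_symm a b, S.e_symm c a]
      exact S.e_comm_adjacent (by simp; tauto)
  by_cases hbc : b = c
  · subst hbc
    exact S.e_comm_adjacent (by simp; tauto)
  by_cases hbd : b = d
  · subst hbd
    rw [S.e_symm c b]
    exact S.e_comm_adjacent (by simp; tauto)
  exact S.e_comm_disjoint (by simp; tauto)

theorem e_mul_e_mul_e (a b c : X) : S.e a b * S.e b c * S.e a c = S.e a b * S.e b c := by
  by_cases hab : a = b
  · subst hab
    simp [S.e_self, S.e_idem]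
  by_cases hbc : b = c
  · subst hbc
    simp [S.e_self, S.e_idem]
  by_cases hac : a = c
  · subst hac
    simp [S.e_self]
  exact S.e_trans (by simp; tauto)

/-- Merging with a point does not depend on the point representing its block. -/
theorem mul_e_congr {m : N} {p q k : X} (hpq : m * S.e p q = m) :
    m * S.e p k = m * S.e q k := by
  have h₁ := congrArg (m * ·) (S.e_mul_e_mul_e p q k)
  have h₂ := congrArg (m * ·) (S.e_mul_e_mul_e q p k)
  simp only [← mul_assoc, S.e_symm q p, hpq] at h₁ h₂
  rw [← h₂, mul_assoc, S.e_comm, ← mul_assoc, h₁]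

/-- The pairs of points whose merging does not change `m` on the right. -/
def rightAbsorbed (m : N) : Setoid X where
  r a b := m * S.e a b = m
  iseqv :=
    { refl a := by simp [S.e_self]
      symm {a b} h := by rw [S.e_symm b a, h]
      trans {a b c} h₁ h₂ := by
        have h := congrArg (m * ·) (S.e_mul_e_mul_e a b c)
        simp only [← mul_assoc, h₁, h₂] at h
        exact h }

/-- The pairs of points whose merging does not change `m` on the left. -/
def leftAbsorbed (m : N) : Setoid X where
  r a b := S.e a b * m = m
  iseqv :=
    { refl a := by simp [S.e_self]
      symm {a b} h := by rw [S.e_symm b a, h]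
      trans {a b c} h₁ h₂ := by
        have hc : Commute (S.e a b * S.e b c) (S.e a c) :=
          Commute.mul_left (S.e_comm _ _ _ _) (S.e_comm _ _ _ _)
        have h := congrArg (· * m) (hc.eq.symm.trans (S.e_mul_e_mul_e a b c))
        simp only [mul_assoc, h₁, h₂] at h
        exact h }

theorem rightAbsorbed_iff {m : N} {a b : X} : S.rightAbsorbed m a b ↔ m * S.e a b = m := Iff.rfl

theorem leftAbsorbed_iff {m : N} {a b : X} : S.leftAbsorbed m a b ↔ S.e a b * m = m := Iff.rfl

theorem mul_swap_of_absorbed {m : N} {a b : X} (h : m * S.e a b = m) :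
    m * S.ρ (Equiv.swap a b) = m := by
  rw [← h, mul_assoc, S.e_swap]

theorem swap_mul_e (a b : X) : S.ρ (Equiv.swap a b) * S.e a b = S.e a b := by
  rw [S.e_conj, Equiv.swap_apply_left, Equiv.swap_apply_right, S.e_symm b a, S.e_swap]

theorem swap_mul_of_absorbed {m : N} {a b : X} (h : S.e a b * m = m) :
    S.ρ (Equiv.swap a b) * m = m := by
  rw [← h, ← mul_assoc, S.swap_mul_e]

/-- Merging a further point into the source block of a move commutes with the move. -/
theorem e_source_comm_z {a b c d : X} (h : [a, b, c, d].Nodup) :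
    S.e a d * S.z a b c = S.z a b c * S.e a d := by
  have h' : [c, d, a, b].Nodup := by simp at h ⊢; tauto
  have h₁ : [a, b, c].Nodup := by simp at h ⊢; tauto
  have h₂ : [c, d, a].Nodup := by simp at h ⊢; tauto
  have h₃ : [a, d, c].Nodup := by simp at h ⊢; tauto
  have key : S.e a d * S.z a b c = S.ρ (Equiv.swap b d) * (S.z a b c * S.e a d) := by
    rw [← mul_assoc, S.z_conj]
    rw [Equiv.swap_apply_left, Equiv.swap_apply_of_ne_of_ne (by simp at h; tauto)
      (by simp at h; tauto),
      Equiv.swap_apply_of_ne_of_ne (by simp at h; tauto) (by simp at h; tauto)]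
    rw [mul_assoc, S.e_conj, Equiv.swap_apply_right,
      Equiv.swap_apply_of_ne_of_ne (by simp at h; tauto) (by simp at h; tauto)]
    rw [← S.z_mul_z h₃, mul_assoc, S.z_mul_z_swap h', ← mul_assoc, ← mul_assoc,
      S.e_symm c d, S.z_mul_e h₃, Equiv.swap_comm, mul_assoc]
  have abs : S.e b d * (S.e a d * S.z a b c) = S.e a d * S.z a b c := by
    have : S.leftAbsorbed (S.e a d * S.z a b c) b d := by
      refine (S.leftAbsorbed _).trans' (y := a) ?_ ?_
      · rw [leftAbsorbed_iff, ← mul_assoc, S.e_comm, mul_assoc, S.e_symm b a, S.e_mul_z h₁]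
      · rw [leftAbsorbed_iff, ← mul_assoc, S.e_idem]
    exact this
  have := S.swap_mul_of_absorbed abs
  rw [key, ← mul_assoc, ← map_mul, Equiv.swap_mul_self, map_one, one_mul] at this
  rw [key, ← this]

/-- Merging a further point into the target block of a move commutes with the move. -/
theorem e_target_comm_z {a b c d : X} (h : [a, b, c, d].Nodup) :
    S.e c d * S.z a b c = S.z a b c * S.e c d := by
  have h₁ : [a, b, c].Nodup := by simp at h ⊢; tauto
  have h₂ : [c, b, a].Nodup := by simp at h ⊢; tauto
  have key := S.e_source_comm_z (a := c) (b := b) (c := a) (d := d) (by simp at h ⊢; tauto)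
  calc S.e c d * S.z a b c = S.e a b * S.e c d * S.z a b c := by
        rw [S.e_comm, mul_assoc, S.e_mul_z h₁]
    _ = S.z a b c * (S.z c b a * S.e c d) * S.z a b c := by
        rw [← mul_assoc, S.z_mul_z h₁]
    _ = S.z a b c * S.e c d * (S.z c b a * S.z a b c) := by
        rw [← key]; simp only [mul_assoc]
    _ = S.z a b c * S.e c d := by
        rw [S.z_mul_z h₂, mul_assoc, S.e_comm, ← mul_assoc, S.e_symm c b, S.z_mul_e h₁]

/-- Merging two points other than the moved one commutes with a move. -/
theorem e_comm_z {a b c : X} (h : [a, b, c].Nodup) {p q : X} (hp : p ≠ b) (hq : q ≠ b) :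
    S.e p q * S.z a b c = S.z a b c * S.e p q := by
  by_cases hpq : p = q
  · simp [hpq, S.e_self]
  by_cases hpa : p = a
  · subst hpa
    by_cases hqc : q = c
    · subst hqc
      exact S.z_comm_e_ends h
    · exact S.e_source_comm_z (by simp at h ⊢; tauto)
  by_cases hqa : q = a
  · subst hqa
    rw [S.e_symm p q]
    by_cases hpc : p = c
    · subst hpc
      exact S.z_comm_e_ends h
    · exact S.e_source_comm_z (by simp at h ⊢; tauto)
  by_cases hpc : p = c
  · subst hpc
    exact S.e_target_comm_z (by simp at h ⊢; tauto)
  by_cases hqc : q = c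
  · subst hqc
    rw [S.e_symm p q]
    exact S.e_target_comm_z (by simp at h ⊢; tauto)
  have h₁ : [a, b, p, c].Nodup := by simp at h ⊢; tauto
  rw [← S.z_mul_z_triangle h₁, ← mul_assoc, S.e_target_comm_z (by simp at h ⊢; tauto), mul_assoc,
    S.e_source_comm_z (by simp at h ⊢; tauto), mul_assoc]

/-- A move within a block has no effect. -/
theorem mul_z_of_absorbed {m : N} {a b c : X} (h : [a, b, c].Nodup) (hab : m * S.e a b = m)
    (hac : m * S.e a c = m) : m * S.z a b c = m := by
  have := congrArg (m * ·) (S.e_mul_e_mul_z h)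
  simpa only [← mul_assoc, hab, hac] using this

/-- A move does not depend on the point representing the source block. -/
theorem mul_z_source {m : N} {a a' b c : X} (h : [a, b, c].Nodup) (h' : [a', b, c].Nodup)
    (hab : m * S.e a b = m) (haa' : m * S.e a a' = m) : m * S.z a b c = m * S.z a' b c := by
  by_cases ha : a = a'
  · rw [ha]
  have h₁ : [a, b, a', c].Nodup := by simp at h h' ⊢; tauto
  rw [← S.z_mul_z_triangle h₁, ← mul_assoc,
    S.mul_z_of_absorbed (by simp at h h' ⊢; tauto) hab haa']

/-- A move does not depend on the point representing the target block. -/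
theorem mul_z_target {m : N} {a b c c' : X} (h : [a, b, c].Nodup) (h' : [a, b, c'].Nodup)
    (hcc' : m * S.e c c' = m) : m * S.z a b c = m * S.z a b c' := by
  by_cases hc : c = c'
  · rw [hc]
  have h₁ : [a, b, c, c'].Nodup := by simp at h h' ⊢; tauto
  rw [← S.z_mul_z_triangle h₁, ← mul_assoc,
    S.mul_z_of_absorbed (m := m * S.z a b c) (by simp at h h' ⊢; tauto)]
  · rw [S.e_symm, mul_assoc, S.z_mul_e h]
  · rw [mul_assoc, ← S.e_comm_z h (by simp at h; tauto) (by simp at h'; tauto), ← mul_assoc, hcc']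

/-- Two points can be moved to the same block in either order. -/
theorem mul_z_mul_z_comm_same {m : N} {a b b' c : X} (h : [a, b, b', c].Nodup)
    (hab : m * S.e a b = m) (hab' : m * S.e a b' = m) :
    m * S.z a b c * S.z a b' c = m * S.z a b' c * S.z a b c := by
  have h₁ : [a, b, c].Nodup := by simp at h ⊢; tauto
  have h₂ : [a, b', c].Nodup := by simp at h ⊢; tauto
  have hbb' : m * S.e b b' = m :=
    (S.rightAbsorbed m).trans' ((S.rightAbsorbed m).symm' hab) hab'
  have habs : m * S.z a b c * S.z a b' c * S.e b b' = m * S.z a b c * S.z a b' c := by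
    refine (S.rightAbsorbed _).trans' (y := c) ?_ ?_
    · rw [rightAbsorbed_iff, mul_assoc _ _ (S.e b c),
        ← S.e_comm_z h₂ (by simp at h; tauto) (by simp at h; tauto), ← mul_assoc, mul_assoc m,
        S.z_mul_e h₁]
    · rw [rightAbsorbed_iff, S.e_symm, mul_assoc _ _ (S.e b' c), S.z_mul_e h₂]
  have hs := S.mul_swap_of_absorbed hbb'
  have ht := S.mul_swap_of_absorbed habs
  have hc : S.ρ (Equiv.swap b b') * S.z a b' c = S.z a b c * S.ρ (Equiv.swap b b') := by
    rw [S.z_conj, Equiv.swap_apply_right, Equiv.swap_apply_of_ne_of_ne (by simp at h; tauto)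
      (by simp at h; tauto), Equiv.swap_apply_of_ne_of_ne (by simp at h; tauto)
      (by simp at h; tauto)]
  have hc' : S.ρ (Equiv.swap b b') * S.z a b c = S.z a b' c * S.ρ (Equiv.swap b b') := by
    rw [S.z_conj, Equiv.swap_apply_left, Equiv.swap_apply_of_ne_of_ne (by simp at h; tauto)
      (by simp at h; tauto), Equiv.swap_apply_of_ne_of_ne (by simp at h; tauto)
      (by simp at h; tauto)]
  symm
  calc m * S.z a b' c * S.z a b c
      = m * S.ρ (Equiv.swap b b') * S.z a b' c * S.z a b c := by rw [hs]
    _ = m * S.z a b c * S.z a b' c * S.ρ (Equiv.swap b b') := by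
        rw [mul_assoc m, hc, ← mul_assoc, mul_assoc _ (S.ρ _), hc', ← mul_assoc]
    _ = _ := ht

/-- Moving two points in two stages is the same as moving them directly. -/
def Braided : Prop := ∀ ⦃a b b' c d : X⦄, [a, b, b', c, d].Nodup →
  S.e a b * S.e a b' * S.z a b c * S.z a b' c * S.z c b d * S.z c b' d =
    S.e a b * S.e a b' * S.z a b d * S.z a b' d

variable {S} in
/-- Two points can be moved to different blocks in either order. -/
theorem Braided.mul_z_mul_z_comm (hS : S.Braided) {m : N} {a b b' c d : X}
    (h : [a, b, b', c, d].Nodup)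
    (hab : m * S.e a b = m) (hab' : m * S.e a b' = m) :
    m * S.z a b d * S.z a b' c = m * S.z a b' c * S.z a b d := by
  have hbraid := congrArg (m * ·) (hS h)
  simp only [← mul_assoc, hab, hab'] at hbraid
  have hb : [a, b, c, d].Nodup := by simp at h ⊢; tauto
  have hb' : [a, b', c, d].Nodup := by simp at h ⊢; tauto
  have h₁ : [a, b', c].Nodup := by simp at h ⊢; tauto
  have h₂ : [c, b, d].Nodup := by simp at h ⊢; tauto
  have h₃ : [c, b', d].Nodup := by simp at h ⊢; tauto
  rw [S.mul_z_mul_z_comm_same (by simp at h ⊢; tauto) hab hab', mul_assoc _ (S.z a b c),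
    S.z_mul_z_triangle hb, ← S.z_mul_z_triangle hb', ← mul_assoc] at hbraid
  have hcancel := congrArg (· * S.z d b' c) hbraid
  simp only [mul_assoc _ (S.z c b' d), S.z_mul_z h₃] at hcancel
  rw [mul_assoc _ (S.z a b d), ← S.e_comm_z (by simp at h ⊢; tauto) (by simp at h; tauto)
    (by simp at h; tauto), ← mul_assoc, mul_assoc m, S.e_symm c b', S.z_mul_e h₁,
    mul_assoc _ (S.z a b' c) (S.e b' c), S.z_mul_e h₁] at hcancel
  exact hcancel.symm

end Algebra

end MoveSystem

namespace MoveSystem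

open Function

section Labellings

variable {X K : Type*}

theorem nodup_three {a b c : X} (hab : a ≠ b) (hac : a ≠ c) (hbc : b ≠ c) : [a, b, c].Nodup := by
  simp
  tauto

theorem nodup_four {a b c d : X} (hab : a ≠ b) (hac : a ≠ c) (had : a ≠ d)
    (h : [b, c, d].Nodup) : [a, b, c, d].Nodup := by
  simp at h ⊢
  tauto

theorem nodup_five {a b c d k : X} (hab : a ≠ b) (hac : a ≠ c) (had : a ≠ d) (hak : a ≠ k)
    (h : [b, c, d, k].Nodup) : [a, b, c, d, k].Nodup := by
  simp at h ⊢
  tauto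

theorem nodup_of_labels {f : X → K} {a b c : X} (hab : f a = f b) (hne : a ≠ b)
    (hc : f a ≠ f c) : [a, b, c].Nodup := by
  have h₁ : a ≠ c := fun h => hc (h ▸ rfl)
  have h₂ : b ≠ c := fun h => hc (h ▸ hab)
  simp
  tauto

theorem update_comp_perm [DecidableEq X] (f : X → K) (b : X) (k : K) (π : Equiv.Perm X) :
    update f b k ∘ π = update (f ∘ π) (π.symm b) k := by
  funext j
  by_cases hj : j = π.symm b
  · simp [hj]
  · rw [update_of_ne hj, comp_apply, update_of_ne, comp_apply]
    rintro rfl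
    simp at hj

theorem surjective_update [DecidableEq X] {f : X → K} (hf : Surjective f) {a b : X}
    (hab : f a = f b)
    (hne : a ≠ b) (k : K) : Surjective (update f b k) := by
  intro l
  obtain ⟨j, rfl⟩ := hf l
  by_cases hj : j = b
  · exact ⟨a, by rw [update_of_ne hne, hab, hj]⟩
  · exact ⟨j, update_of_ne hj _ _⟩

/-- Two surjective labellings that are injective outside the label `h` differ by a permutation. -/
theorem exists_perm_of_injOn [Finite X] {c f : X → K} {h : K} (hc : Surjective c)
    (hf : Surjective f)
    (hci : ∀ a b, c a = c b → c a ≠ h → a = b) (hfi : ∀ a b, f a = f b → f a ≠ h → a = b) :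
    ∃ π : Equiv.Perm X, f = c ∘ π := by
  choose σ hσ using hc
  choose τ hτ using hf
  have : Finite K := Finite.of_surjective f fun k => ⟨τ k, hτ k⟩
  obtain ⟨π, hπ⟩ := Equiv.Perm.exists_extending_pair (fun k : {k // k ≠ h} => τ k)
    (fun k => σ k) (fun k l hkl => Subtype.ext (by rw [← hτ k, ← hτ l]; exact congrArg f hkl))
    (fun k l hkl => Subtype.ext (by rw [← hσ k, ← hσ l]; exact congrArg c hkl))
  have hπ' : ∀ k, k ≠ h → π (τ k) = σ k := fun k hk => by
    simpa using hπ ⟨k, hk⟩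
  refine ⟨π, funext fun j => ?_⟩
  by_cases hj : f j = h
  · by_contra hne
    have hcj : c (π j) ≠ h := fun h' => hne (by rw [comp_apply, hj, h'])
    have h₁ : π j = σ (c (π j)) := hci _ _ (hσ _).symm hcj
    rw [← hπ' _ hcj] at h₁
    have h₂ := π.injective h₁
    apply hcj
    rw [← hτ (c (π j)), ← h₂, hj]
  · have h₁ : j = τ (f j) := hfi _ _ (hτ _).symm hj
    rw [comp_apply]
    conv_rhs => rw [h₁, hπ' _ hj, hσ]

/-- A labelling of the points by the blocks of `r` in which all blocks except one are
singletons. -/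
theorem exists_hub_labelling [Nonempty X] (r : Setoid X) : ∃ (c : X → Quotient r)
    (h : Quotient r), Surjective c ∧ ∀ a b, c a = c b → c a ≠ h → a = b := by
  classical
  obtain ⟨p⟩ := ‹Nonempty X›
  refine ⟨fun j => if (Quotient.mk r j).out = j then Quotient.mk r j else Quotient.mk r p,
    Quotient.mk r p, fun k => ⟨k.out, by simp⟩, fun a b hab ha => ?_⟩
  dsimp only at hab ha
  split_ifs at hab ha with h₁ h₂
  · rw [← h₁, ← h₂, hab]
  · exact absurd hab ha
  · exact absurd rfl ha
  · exact absurd rfl ha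

theorem exists_merge (r : Setoid X) (i j : X) : ∃ r' : Setoid X, r ≤ r' ∧ r' i j ∧
    ∀ t : Setoid X, r ≤ t → t i j → r' ≤ t := by
  refine ⟨r ⊔ Relation.EqvGen.setoid fun a b => a = i ∧ b = j, le_sup_left, ?_, fun t h h' => ?_⟩
  · exact (le_sup_right : _ ≤ r ⊔ _) (Relation.EqvGen.rel _ _ ⟨rfl, rfl⟩)
  · refine sup_le h (Setoid.eqvGen_le ?_)
    rintro a b ⟨rfl, rfl⟩
    exact h'

end Labellings

section Paths

variable {X N K : Type*} [DecidableEq X] [Monoid N] (S : MoveSystem X N)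

/-- Merging points with the same label does not change `m` on the right. -/
def Absorbs (f : X → K) (m : N) : Prop := ∀ ⦃a b : X⦄, f a = f b → m * S.e a b = m

theorem Absorbs.perm {f : X → K} {m : N} (hm : S.Absorbs f m) (π : Equiv.Perm X) :
    S.Absorbs (f ∘ π) (m * S.ρ π) := by
  intro a b hab
  rw [mul_assoc, S.e_conj, ← mul_assoc, hm hab]

theorem Absorbs.move {f : X → K} {m : N} (hm : S.Absorbs f m) {a b c : X} (hab : f a = f b)
    (hne : a ≠ b) (hc : f a ≠ f c) : S.Absorbs (update f b (f c)) (m * S.z a b c) := by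
  have h := nodup_of_labels hab hne hc
  have hcb : c ≠ b := by simp at h; tauto
  have off : ∀ {p q : X}, p ≠ b → q ≠ b → f p = f q →
      m * S.z a b c * S.e p q = m * S.z a b c := by
    intro p q hp hq hpq
    rw [mul_assoc, ← S.e_comm_z h hp hq, ← mul_assoc, hm hpq]
  have hbc : m * S.z a b c * S.e b c = m * S.z a b c := by rw [mul_assoc, S.z_mul_e h]
  have at_b : ∀ {q : X}, q ≠ b → f c = f q → m * S.z a b c * S.e b q = m * S.z a b c :=
    fun hq h' => (S.rightAbsorbed _).trans' hbc (off hcb hq h')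
  intro p q hpq
  by_cases hp : p = b <;> by_cases hq : q = b
  · rw [hp, hq, S.e_self, mul_one]
  · subst hp
    rw [update_self, update_of_ne hq] at hpq
    exact at_b hq hpq
  · subst hq
    rw [update_self, update_of_ne hp] at hpq
    rw [S.e_symm]
    exact at_b hp hpq.symm
  · rw [update_of_ne hp, update_of_ne hq] at hpq
    exact off hp hq hpq

/-- Pulling back a left absorption property along a move. -/
theorem left_absorbs_move {f : X → K} {a b c : X} (hab : f a = f b) (hne : a ≠ b)
    (hc : f a ≠ f c) {y : N}
    (hy : ∀ p q, update f b (f c) p = update f b (f c) q → S.e p q * y = y) (p q : X)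
    (hpq : f p = f q) : S.e p q * (S.z a b c * y) = S.z a b c * y := by
  have h := nodup_of_labels hab hne hc
  have off : ∀ {p q : X}, p ≠ b → q ≠ b → f p = f q →
      S.e p q * (S.z a b c * y) = S.z a b c * y := by
    intro p q hp hq hpq
    rw [← mul_assoc, S.e_comm_z h hp hq, mul_assoc, hy]
    rwa [update_of_ne hp, update_of_ne hq]
  have hba : S.e b a * (S.z a b c * y) = S.z a b c * y := by
    rw [← mul_assoc, S.e_symm, S.e_mul_z h]
  have at_b : ∀ {q : X}, q ≠ b → f b = f q → S.e b q * (S.z a b c * y) = S.z a b c * y :=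
    fun hq h' => (S.leftAbsorbed _).trans' hba (off hne hq (hab.trans h'))
  by_cases hp : p = b <;> by_cases hq : q = b
  · rw [hp, hq, S.e_self, one_mul]
  · subst hp
    exact at_b hq hpq
  · subst hq
    rw [S.e_symm]
    exact at_b hp hpq.symm
  · exact off hp hq hpq

theorem z_mul_perm (π : Equiv.Perm X) (a b c : X) :
    S.z a b c * S.ρ π = S.ρ π * S.z (π.symm a) (π.symm b) (π.symm c) := by
  rw [S.z_conj]
  simp

variable [Fintype X]

/-- Right multiplication by a label-preserving permutation has no effect. -/
theorem Absorbs.mul_perm {f : X → K} {m : N} (hm : S.Absorbs f m) (π : Equiv.Perm X)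
    (hπ : f ∘ π = f) : m * S.ρ π = m := by
  induction h : π.support.card using Nat.strong_induction_on generalizing π with
  | _ k ih =>
    by_cases h1 : π = 1
    · simp [h1]
    obtain ⟨a, ha⟩ : ∃ a, π a ≠ a := by
      by_contra! hcon
      exact h1 (Equiv.ext hcon)
    have hfa : f a = f (π a) := (congrFun hπ a).symm
    have hsw : f ∘ Equiv.swap a (π a) = f := by
      funext j
      simp only [comp_apply, Equiv.swap_apply_def]
      split_ifs with h₁ h₂
      · rw [h₁, hfa]
      · rw [h₂, hfa]
      · rfl
    have key := ih _ (h ▸ Equiv.Perm.card_support_swap_mul ha) (Equiv.swap a (π a) * π)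
      (by rw [Equiv.Perm.coe_mul, ← comp_assoc, hsw, hπ]) rfl
    rwa [map_mul, ← mul_assoc, S.mul_swap_of_absorbed (hm hfa)] at key

open Classical in
/-- The idempotent merging all points related by `r`. -/
noncomputable def E (r : Setoid X) : N :=
  ((Finset.univ.toList : List (X × X)).map fun p => if r p.1 p.2 then S.e p.1 p.2 else 1).prod

theorem commute_E (r : Setoid X) (a b : X) : Commute (S.e a b) (S.E r) := by
  refine Commute.list_prod_right _ _ fun x hx => ?_
  obtain ⟨p, -, rfl⟩ := List.mem_map.1 hx
  split_ifs
  · exact S.e_comm _ _ _ _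
  · exact Commute.one_right _

theorem E_mul_of_absorbed {r : Setoid X} {y : N} (hy : ∀ a b, r a b → S.e a b * y = y) :
    S.E r * y = y := by
  unfold E
  induction (Finset.univ.toList : List (X × X)) with
  | nil => simp
  | cons p l ih =>
    rw [List.map_cons, List.prod_cons, mul_assoc, ih]
    split_ifs with h
    · exact hy _ _ h
    · exact one_mul _

theorem e_mul_E {r : Setoid X} {a b : X} (hab : r a b) : S.e a b * S.E r = S.E r := by
  have key : ∀ l : List (X × X), (a, b) ∈ l → ∀ w : X × X → N,
      (∀ p q, Commute (w p) (w q)) → w (a, b) * w (a, b) = w (a, b) →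
      w (a, b) * (l.map w).prod = (l.map w).prod := by
    intro l hl w hw hi
    induction l with
    | nil => simp at hl
    | cons p l ih =>
      rw [List.map_cons, List.prod_cons]
      rcases List.mem_cons.1 hl with h | h
      · rw [← h, ← mul_assoc, hi]
      · rw [← mul_assoc, (hw _ _).eq, mul_assoc, ih h]
  classical
  have := key Finset.univ.toList (by simp) (fun p => if r p.1 p.2 then S.e p.1 p.2 else 1) ?_ ?_
  · simp only [hab, if_true] at this
    exact this
  · intro p q
    split_ifs
    · exact S.e_comm _ _ _ _
    · exact Commute.one_right _
    · exact Commute.one_left _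
    · exact Commute.one_left _
  · simp only [hab, if_true, S.e_idem]

theorem E_absorbs (r : Setoid X) : S.Absorbs (Quotient.mk r) (S.E r) := by
  intro a b hab
  rw [← (S.commute_E r a b).eq, S.e_mul_E (Quotient.exact hab)]

theorem E_ker_absorbs (c : X → K) : S.Absorbs c (S.E (Setoid.ker c)) := by
  intro a b hab
  rw [← (S.commute_E _ a b).eq, S.e_mul_E hab]

theorem E_bot : S.E (⊥ : Setoid X) = 1 := by
  rw [← mul_one (S.E ⊥)]
  refine S.E_mul_of_absorbed fun a b hab => ?_
  rw [show a = b from hab, S.e_self, one_mul]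

theorem mul_E_of_absorbs {r : Setoid X} {m : N} (hm : S.Absorbs (Quotient.mk r) m) :
    m * S.E r = m := by
  unfold E
  induction (Finset.univ.toList : List (X × X)) with
  | nil => simp
  | cons p l ih =>
    rw [List.map_cons, List.prod_cons, ← mul_assoc]
    split_ifs with h
    · rw [hm (Quotient.sound h), ih]
    · rw [mul_one, ih]

/-- The states reached from the labelling `c` by permuting and then moving points out of the
block labelled `h`, with the corresponding elements of `N`. -/
inductive Hub (c : X → K) (h : K) : (X → K) → N → Prop
  | base (π : Equiv.Perm X) : Hub c h (c ∘ π) (S.E (Setoid.ker c) * S.ρ π)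
  | step {f : X → K} {m : N} {a b d : X} : Hub c h f m → f a = h → f b = h → a ≠ b → f d ≠ h →
      Hub c h (update f b (f d)) (m * S.z a b d)

variable {S} {c : X → K} {h : K}

theorem Hub.inversion {f : X → K} {m : N} (H : S.Hub c h f m) :
    (∃ π : Equiv.Perm X, f = c ∘ π ∧ m = S.E (Setoid.ker c) * S.ρ π) ∨
    ∃ (f' : X → K) (m' : N) (a b d : X), S.Hub c h f' m' ∧ f' a = h ∧ f' b = h ∧ a ≠ b ∧
      f' d ≠ h ∧ f = update f' b (f' d) ∧ m = m' * S.z a b d := by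
  cases H with
  | base π => exact Or.inl ⟨π, rfl, rfl⟩
  | step H ha hb hab hd => exact Or.inr ⟨_, _, _, _, _, H, ha, hb, hab, hd, rfl, rfl⟩

theorem Hub.absorbs {f : X → K} {m : N} (H : S.Hub c h f m) : S.Absorbs f m := by
  induction H with
  | base π => exact (S.E_ker_absorbs c).perm S π
  | step H ha hb hab hd ih => exact ih.move S (ha.trans hb.symm) hab (by rw [ha]; exact hd.symm)

theorem Hub.perm {f : X → K} {m : N} (H : S.Hub c h f m) (π : Equiv.Perm X) :
    S.Hub c h (f ∘ π) (m * S.ρ π) := by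
  induction H with
  | base π' =>
    rw [mul_assoc, ← map_mul]
    exact Hub.base (π' * π)
  | @step f m a b d H ha hb hab hd ih =>
    rw [update_comp_perm, mul_assoc, S.z_mul_perm, ← mul_assoc]
    have := Hub.step (a := π.symm a) (b := π.symm b) (d := π.symm d) ih (by simpa) (by simpa)
      (by simpa) (by simpa)
    simpa using this

theorem Hub.surjective (hc : Surjective c) {f : X → K} {m : N} (H : S.Hub c h f m) :
    Surjective f := by
  induction H with
  | base π => exact hc.comp π.surjective
  | step H ha hb hab hd ih => exact surjective_update ih (ha.trans hb.symm) hab _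

open Classical in
/-- The number of points whose label is not `h`. -/
noncomputable def offCard (h : K) (f : X → K) : ℕ := (Finset.univ.filter fun j => f j ≠ h).card

theorem offCard_update_lt {f : X → K} {b : X} (hb : f b ≠ h) :
    offCard h (update f b h) < offCard h f := by
  classical
  refine Finset.card_lt_card ⟨fun j hj => ?_, fun hsub => ?_⟩
  · simp only [Finset.mem_filter, Finset.mem_univ, true_and] at hj ⊢
    by_cases hjb : j = b
    · simp [hjb] at hj
    · rwa [update_of_ne hjb] at hj
  · have := hsub (show b ∈ _ by simpa using hb)
    simp at this

theorem exists_hub (S : MoveSystem X N) (hc : Surjective c)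
    (hci : ∀ a b, c a = c b → c a ≠ h → a = b) (f : X → K) (hf : Surjective f) :
    ∃ m, S.Hub c h f m := by
  induction hk : offCard h f using Nat.strong_induction_on generalizing f with
  | _ k ih =>
    by_cases hfi : ∀ a b, f a = f b → f a ≠ h → a = b
    · obtain ⟨π, rfl⟩ := exists_perm_of_injOn hc hf hci hfi
      exact ⟨_, Hub.base π⟩
    · push Not at hfi
      obtain ⟨d, b, hdb, hdh, hne⟩ := hfi
      have hbh : f b ≠ h := hdb ▸ hdh
      obtain ⟨a, ha⟩ := hf h
      have hab : a ≠ b := by rintro rfl; exact hbh ha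
      obtain ⟨m, H⟩ := ih _ (hk ▸ offCard_update_lt hbh) (update f b h)
        (surjective_update hf hdb hne h) rfl
      have := Hub.step H (a := a) (b := b) (d := d) (by rwa [update_of_ne hab]) (by simp) hab
        (by rwa [update_of_ne hne])
      rw [update_idem, update_of_ne hne, hdb, update_eq_self] at this
      exact ⟨_, this⟩

/-- The element attached to a state does not depend on the order of the moves. -/
theorem Hub.unique (hS : S.Braided) (hc : Surjective c) (hci : ∀ a b, c a = c b → c a ≠ h → a = b)
    {f : X → K}
    {m m' : N} (H : S.Hub c h f m) (H' : S.Hub c h f m') : m = m' := by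
  induction hk : offCard h f using Nat.strong_induction_on generalizing f m m' with
  | _ k ih =>
    have hf := H.surjective hc
    have step_not_base : ∀ {f' : X → K} {b d : X} {π : Equiv.Perm X}, f' b = h → f' d ≠ h →
        update f' b (f' d) ≠ c ∘ π := by
      intro f' b d π hb hd heq
      have hdb : d ≠ b := by rintro rfl; exact hd hb
      have h₁ := congrFun heq b
      have h₂ := congrFun heq d
      rw [update_self] at h₁
      rw [update_of_ne hdb] at h₂
      refine hdb (π.injective (hci _ _ (h₂.symm.trans h₁) ?_))
      exact fun h' => hd (h₂.trans h')
    rcases H.inversion with ⟨π, hfπ, rfl⟩ | ⟨f₁, m₁, a, b, d, H₁, ha, hb, hab, hd, hf₁, rfl⟩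
    · rcases H'.inversion with ⟨π', hfπ', rfl⟩ |
        ⟨f₂, m₂, a', b', d', H₂, ha', hb', hab', hd', hf₂, rfl⟩
      · have hpres : c ∘ (π * π'⁻¹) = c := by
          rw [Equiv.Perm.coe_mul, ← comp_assoc, ← hfπ, hfπ', comp_assoc, ← Equiv.Perm.coe_mul]
          simp
        have := (S.E_ker_absorbs c).mul_perm S _ hpres
        conv_rhs => rw [← this]
        rw [mul_assoc, ← map_mul, inv_mul_cancel_right]
      · exact absurd (hf₂.symm.trans hfπ) (step_not_base hb' hd')
    rcases H'.inversion with ⟨π', hfπ', rfl⟩ |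
      ⟨f₂, m₂, a', b', d', H₂, ha', hb', hab', hd', hf₂, rfl⟩
    · exact absurd (hf₁.symm.trans hfπ') (step_not_base hb hd)
    have hdb : d ≠ b := by rintro rfl; exact hd hb
    have hdb' : d' ≠ b' := by rintro rfl; exact hd' hb'
    have hf₁' : f₁ = update f b h := by rw [hf₁, update_idem, ← hb, update_eq_self]
    have hf₂' : f₂ = update f b' h := by rw [hf₂, update_idem, ← hb', update_eq_self]
    have fb : f b = f d := by rw [hf₁, update_self, update_of_ne hdb]
    have fb' : f b' = f d' := by rw [hf₂, update_self, update_of_ne hdb']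
    have fa : f a = h := by rw [hf₁, update_of_ne hab, ha]
    have fa' : f a' = h := by rw [hf₂, update_of_ne hab', ha']
    have fd : f d ≠ h := by rwa [hf₁, update_of_ne hdb]
    have fd' : f d' ≠ h := by rwa [hf₂, update_of_ne hdb']
    have fbh : f b ≠ h := fb ▸ fd
    have fbh' : f b' ≠ h := fb' ▸ fd'
    have lt : offCard h f₁ < k := by rw [← hk, hf₁']; exact offCard_update_lt fbh
    have lt' : offCard h f₂ < k := by rw [← hk, hf₂']; exact offCard_update_lt fbh'
    have nd : [a, b, d].Nodup := nodup_of_labels (ha.trans hb.symm) hab (by rw [ha]; exact hd.symm)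
    have nd' : [a', b', d'].Nodup :=
      nodup_of_labels (ha'.trans hb'.symm) hab' (by rw [ha']; exact hd'.symm)
    have haa' : f₂ a = f₂ a' := by
      rw [ha', hf₂', update_of_ne _ , fa]
      rintro rfl; exact fbh' fa
    have hab₂ : a ≠ b' := by rintro rfl; exact fbh' fa
    have nd'' : [a, b', d'].Nodup :=
      nodup_of_labels (haa'.trans (ha'.trans hb'.symm)) hab₂ (by rw [haa', ha']; exact hd'.symm)
    have hsrc : m₂ * S.z a' b' d' = m₂ * S.z a b' d' :=
      S.mul_z_source nd' nd'' (H₂.absorbs (ha'.trans hb'.symm)) (H₂.absorbs haa'.symm)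
    rw [hsrc]
    by_cases hbb' : b = b'
    · subst hbb'
      obtain rfl : f₁ = f₂ := hf₁'.trans hf₂'.symm
      obtain rfl : m₁ = m₂ := ih _ lt H₁ H₂ rfl
      refine S.mul_z_target nd nd'' (H₁.absorbs ?_)
      rw [hf₁', update_of_ne hdb, update_of_ne hdb', ← fb, fb']
    have common : ∀ {p q : X}, p ≠ b → p ≠ b' → q ≠ b → q ≠ b' → f p = f b → f q = f b' →
        m₁ * S.z a b p = m₂ * S.z a b' q := by
      intro p q hpb hpb' hqb hqb' hp hq
      have hsurj : Surjective (update f₁ b' h) := by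
        refine surjective_update (H₁.surjective hc) (a := q) ?_ hqb' h
        rw [hf₁', update_of_ne hqb, update_of_ne (Ne.symm hbb'), hq]
      obtain ⟨m₀, H₀⟩ := exists_hub S hc hci _ hsurj
      have e₀ : update f₁ b' h = update (update f b h) b' h := by rw [hf₁']
      rw [e₀] at H₀
      have e₁ : update (update (update f b h) b' h) b' (f b') = f₁ := by
        rw [update_idem, hf₁']
        exact update_eq_self_iff.2 (by rw [update_of_ne (Ne.symm hbb')])
      have e₂ : update (update (update f b h) b' h) b (f b) = f₂ := by
        rw [update_comm hbb', update_idem, update_comm (Ne.symm hbb'), update_eq_self, hf₂']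
      have vq : update (update f b h) b' h q = f b' := by
        rw [update_of_ne hqb', update_of_ne hqb, hq]
      have vp : update (update f b h) b' h p = f b := by
        rw [update_of_ne hpb', update_of_ne hpb, hp]
      have va : update (update f b h) b' h a = h := by
        rw [update_of_ne hab₂, update_of_ne hab, fa]
      have vb : update (update f b h) b' h b = h := by
        rw [update_of_ne hbb', update_self]
      have vb' : update (update f b h) b' h b' = h := update_self ..
      have K₁ := H₀.step va vb' hab₂ (d := q) (by rwa [vq])
      have K₂ := H₀.step va vb hab (d := p) (by rwa [vp])
      rw [vq, e₁] at K₁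
      rw [vp, e₂] at K₂
      rw [ih _ lt H₁ K₁ rfl, ih _ lt' H₂ K₂ rfl]
      have hap : a ≠ p := by rintro rfl; exact fbh (hp.symm.trans fa)
      have haq : a ≠ q := by rintro rfl; exact fbh' (hq.symm.trans fa)
      by_cases hpq : p = q
      · subst hpq
        exact S.mul_z_mul_z_comm_same
          (nodup_four hab₂ hab hap (nodup_three (Ne.symm hbb') hpb'.symm hpb.symm))
            (H₀.absorbs (va.trans vb'.symm))
          (H₀.absorbs (va.trans vb.symm))
      · exact hS.mul_z_mul_z_comm (nodup_five hab₂ hab hap haq (nodup_four (Ne.symm hbb')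
          hpb'.symm hqb'.symm (nodup_three hpb.symm hqb.symm hpq))) (H₀.absorbs (va.trans vb'.symm))
          (H₀.absorbs (va.trans vb.symm))
    have tgt : ∀ {p : X}, p ≠ b → f p = f b → m₁ * S.z a b d = m₁ * S.z a b p := by
      intro p hpb hp
      refine S.mul_z_target nd (nodup_three hab ?_ hpb.symm) (H₁.absorbs ?_)
      · rintro rfl
        exact fbh (hp.symm.trans fa)
      · rw [hf₁', update_of_ne hdb, update_of_ne hpb, ← fb, hp]
    have tgt' : ∀ {q : X}, q ≠ b' → f q = f b' → m₂ * S.z a b' d' = m₂ * S.z a b' q := by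
      intro q hqb hq
      refine S.mul_z_target nd'' (nodup_three hab₂ ?_ hqb.symm) (H₂.absorbs ?_)
      · rintro rfl
        exact fbh' (hq.symm.trans fa)
      · rw [hf₂', update_of_ne hdb', update_of_ne hqb, ← fb', hq]
    by_cases hlab : f b = f b'
    · by_cases hthird : ∃ p, p ≠ b ∧ p ≠ b' ∧ f p = f b
      · obtain ⟨p, hpb, hpb', hp⟩ := hthird
        rw [tgt hpb hp, tgt' hpb' (hp.trans hlab)]
        exact common hpb hpb' hpb hpb' hp (hp.trans hlab)
      · have hswap : f₁ ∘ Equiv.swap b b' = f₂ := by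
          funext j
          rw [comp_apply, Equiv.swap_apply_def]
          split_ifs with h₁ h₂
          · rw [h₁, hf₁', hf₂', update_of_ne (Ne.symm hbb'), update_of_ne hbb', hlab]
          · rw [h₂, hf₁', hf₂', update_self, update_self]
          · rw [hf₁', hf₂', update_of_ne h₁, update_of_ne h₂]
        have K₂ := H₁.perm (Equiv.swap b b')
        rw [hswap] at K₂
        rw [tgt (Ne.symm hbb') hlab.symm, tgt' hbb' hlab, ih _ lt' H₂ K₂ rfl, mul_assoc, S.z_conj,
          Equiv.swap_apply_left, Equiv.swap_apply_right,
          Equiv.swap_apply_of_ne_of_ne hab hab₂, ← mul_assoc]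
        refine (S.mul_swap_of_absorbed ?_).symm
        rw [mul_assoc, S.z_mul_e (nodup_three hab hab₂ hbb')]
    · have hdb₂ : d ≠ b' := by rintro rfl; exact hlab fb
      have hdb₂' : d' ≠ b := by rintro rfl; exact hlab fb'.symm
      exact common hdb hdb₂ hdb₂' hdb' fb.symm fb'.symm

end Paths

end MoveSystem

namespace MoveSystem

open Function

section Reachability

variable {X N K : Type*} [DecidableEq X] [Monoid N] [Fintype X] {S : MoveSystem X N}
variable {c : X → K} {h : K}

theorem Hub.move (hS : S.Braided) (hc : Surjective c)
    (hci : ∀ a b, c a = c b → c a ≠ h → a = b) {f : X → K}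
    {m : N} (H : S.Hub c h f m) {a b d : X} (hab : f a = f b) (hne : a ≠ b) (hd : f a ≠ f d) :
    S.Hub c h (update f b (f d)) (m * S.z a b d) := by
  by_cases ha : f a = h
  · exact H.step ha (hab ▸ ha) hne (ha ▸ hd.symm)
  have nd := nodup_of_labels hab hne hd
  have hdb : d ≠ b := by simp at nd; tauto
  have hf := H.surjective hc
  obtain ⟨m', H'⟩ := exists_hub S hc hci _ (surjective_update hf hab hne h)
  have back : ∀ {p : X}, f p = h → S.Hub c h f (m' * S.z p b a) := by
    intro p hp
    have hpb : p ≠ b := by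
      rintro rfl
      exact ha (hab.trans hp)
    have := H'.step (a := p) (b := b) (d := a) (by rwa [update_of_ne hpb]) (by simp) hpb
      (by rwa [update_of_ne hne])
    rwa [update_of_ne hne, hab, update_idem, update_eq_self] at this
  by_cases hdh : f d = h
  · rw [H.unique hS hc hci (back hdh), mul_assoc, S.z_mul_z (by simp at nd ⊢; tauto),
      H'.absorbs (by rw [update_of_ne hdb, hdh, update_self]), hdh]
    exact H'
  · obtain ⟨p, hp⟩ := hf h
    have hpb : p ≠ b := by
      rintro rfl
      exact ha (hab.trans hp)
    have hpa : p ≠ a := by rintro rfl; exact ha hp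
    have hpd : p ≠ d := by rintro rfl; exact hdh hp
    rw [H.unique hS hc hci (back hp), mul_assoc, S.z_mul_z_triangle (by simp at nd ⊢; tauto)]
    have := H'.step (a := p) (b := b) (d := d) (by rwa [update_of_ne hpb]) (by simp) hpb
      (by rwa [update_of_ne hdb])
    rwa [update_of_ne hdb, update_idem] at this

theorem Hub.exists_leftInverse {f : X → K} {m : N} (H : S.Hub c h f m) :
    ∃ A : N, ∀ y, (∀ p q, f p = f q → S.e p q * y = y) → A * (m * y) = y := by
  induction H with
  | base π =>
    refine ⟨S.ρ π⁻¹, fun y hy => ?_⟩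
    rw [mul_assoc, S.E_mul_of_absorbed (y := S.ρ π * y), ← mul_assoc, ← map_mul, inv_mul_cancel,
      map_one, one_mul]
    intro a b hab
    rw [← hy (π⁻¹ a) (π⁻¹ b) (by simpa using hab), ← mul_assoc (S.ρ π), S.e_conj]
    simp [← mul_assoc, S.e_idem]
  | @step f m a b d H ha hb hab hd ih =>
    obtain ⟨A, hA⟩ := ih
    have hd' : f a ≠ f d := by rw [ha]; exact hd.symm
    have nd := nodup_of_labels (ha.trans hb.symm) hab hd'
    have hdb : d ≠ b := by rintro rfl; exact hd hb
    refine ⟨S.z d b a * A, fun y hy => ?_⟩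
    rw [mul_assoc m, mul_assoc (S.z d b a),
      hA _ (S.left_absorbs_move (ha.trans hb.symm) hab hd' hy),
      ← mul_assoc, S.z_mul_z (by simp at nd ⊢; tauto), hy]
    rw [update_self, update_of_ne hdb]

/-- The block bijections reached from the partition `r` by permutations and moves, encoded by
their labelling of the points by the blocks of `r`, with the corresponding elements of `N`. -/
inductive Reach (S : MoveSystem X N) (r : Setoid X) : (X → Quotient r) → N → Prop
  | base : Reach S r (Quotient.mk r) (S.E r)
  | perm {f : X → Quotient r} {m : N} (π : Equiv.Perm X) : Reach S r f m →
      Reach S r (f ∘ π) (m * S.ρ π)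
  | move {f : X → Quotient r} {m : N} {a b c : X} : Reach S r f m → f a = f b → a ≠ b →
      f a ≠ f c → Reach S r (update f b (f c)) (m * S.z a b c)

variable {r : Setoid X}

theorem Reach.absorbs {f : X → Quotient r} {m : N} (H : S.Reach r f m) : S.Absorbs f m := by
  induction H with
  | base => exact S.E_absorbs r
  | perm π H ih => exact ih.perm S π
  | move H hab hne hc ih => exact ih.move S hab hne hc

theorem Reach.surjective {f : X → Quotient r} {m : N} (H : S.Reach r f m) : Surjective f := by
  induction H with
  | base => exact Quotient.mk_surjective
  | perm π H ih => exact ih.comp π.surjective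
  | move H hab hne hc ih => exact surjective_update ih hab hne _

theorem Reach.left_absorbs {f : X → Quotient r} {m : N} (H : S.Reach r f m) {a b : X}
    (hab : r a b) : S.e a b * m = m := by
  induction H with
  | base => exact S.e_mul_E hab
  | perm π H ih => rw [← mul_assoc, ih]
  | move H _ _ _ ih => rw [← mul_assoc, ih]

theorem Reach.unique (hS : S.Braided) {f : X → Quotient r} {m m' : N} (H : S.Reach r f m)
    (H' : S.Reach r f m') : m = m' := by
  rcases isEmpty_or_nonempty X with hX | hX
  · have key : ∀ {f : X → Quotient r} {m : N}, S.Reach r f m → m = S.E r := by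
      intro f m H
      induction H with
      | base => rfl
      | perm π H ih => rw [Subsingleton.elim π 1, map_one, mul_one, ih]
      | @move _ _ a _ _ => exact isEmptyElim a
    rw [key H, key H']
  obtain ⟨c, h, hc, hci⟩ := exists_hub_labelling r
  obtain ⟨m₀, H₀⟩ := exists_hub S hc hci (Quotient.mk r) Quotient.mk_surjective
  have key : ∀ {f : X → Quotient r} {m : N}, S.Reach r f m → S.Hub c h f (m₀ * m) := by
    intro f m H
    induction H with
    | base => rwa [S.mul_E_of_absorbs H₀.absorbs]
    | perm π H ih => rw [← mul_assoc]; exact ih.perm π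
    | move H hab hne hd ih => rw [← mul_assoc]; exact ih.move hS hc hci hab hne hd
  have heq := (key H).unique hS hc hci (key H')
  obtain ⟨A, hA⟩ := H₀.exists_leftInverse
  rw [← hA m fun p q hpq => H.left_absorbs (Quotient.exact hpq), heq,
    hA m' fun p q hpq => H'.left_absorbs (Quotient.exact hpq)]

theorem exists_reach (S : MoveSystem X N) (f : X → Quotient r) (hf : Surjective f) :
    ∃ m, S.Reach r f m := by
  rcases isEmpty_or_nonempty X with hX | hX
  · exact ⟨_, Subsingleton.elim (Quotient.mk r) f ▸ Reach.base⟩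
  obtain ⟨c, h, hc, hci⟩ := exists_hub_labelling r
  have key : ∀ {f : X → Quotient r} {m : N}, S.Hub c h f m →
      ((∃ m, S.Reach r f m) ↔ ∃ m, S.Reach r c m) := by
    intro f m H
    induction H with
    | base π =>
      refine ⟨fun ⟨m, H⟩ => ⟨m * S.ρ π⁻¹, ?_⟩, fun ⟨m, H⟩ => ⟨_, H.perm π⟩⟩
      have := H.perm π⁻¹
      rwa [comp_assoc, ← Equiv.Perm.coe_mul, mul_inv_cancel, Equiv.Perm.coe_one, comp_id] at this
    | @step f m a b d H ha hb hab hd ih =>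
      rw [← ih]
      have hdb : d ≠ b := by rintro rfl; exact hd hb
      refine ⟨fun ⟨m, H⟩ => ⟨m * S.z d b a, ?_⟩, fun ⟨m, H⟩ =>
        ⟨_, H.move (ha.trans hb.symm) hab (by rw [ha]; exact hd.symm)⟩⟩
      have := H.move (a := d) (b := b) (c := a) (by rw [update_self, update_of_ne hdb]) hdb
        (by rw [update_of_ne hdb, update_of_ne hab, ha]; exact hd)
      rwa [update_of_ne hab, update_idem, ha, ← hb, update_eq_self] at this
  obtain ⟨m₁, H₁⟩ := exists_hub S hc hci f hf
  obtain ⟨m₂, H₂⟩ := exists_hub S hc hci (Quotient.mk r) Quotient.mk_surjective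
  exact (key H₁).2 ((key H₂).1 ⟨_, Reach.base⟩)

/-- Merging two points on the right amounts to merging the corresponding blocks on the left. -/
theorem Reach.mul_e {f : X → Quotient r} {m : N} (H : S.Reach r f m) {a b i j : X}
    (ha : f a = Quotient.mk r i) (hb : f b = Quotient.mk r j) : m * S.e a b = S.e i j * m := by
  induction H generalizing a b i j with
  | base =>
    rw [(S.commute_E r i j).eq, S.mul_e_congr (S.E_absorbs r ha), S.e_symm i b,
      S.mul_e_congr (S.E_absorbs r hb), S.e_symm]
  | perm π H ih =>
    rw [mul_assoc, S.e_conj, ← mul_assoc, ih ha hb, mul_assoc]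
  | @move f m p q k H hpq hne hk ih =>
    have nd := nodup_of_labels hpq hne hk
    have hkq : k ≠ q := by simp at nd; tauto
    have abs : m * S.z p q k * S.e q k = m * S.z p q k := by rw [mul_assoc, S.z_mul_e nd]
    have off : ∀ {a b i j : X}, a ≠ q → b ≠ q → f a = Quotient.mk r i → f b = Quotient.mk r j →
        m * S.z p q k * S.e a b = S.e i j * (m * S.z p q k) := by
      intro a b i j haq hbq ha hb
      rw [mul_assoc, ← S.e_comm_z nd haq hbq, ← mul_assoc, ih ha hb, mul_assoc]
    have half : ∀ {a b i j : X}, b ≠ q → update f q (f k) a = Quotient.mk r i →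
        f b = Quotient.mk r j → m * S.z p q k * S.e a b = S.e i j * (m * S.z p q k) := by
      intro a b i j hbq ha hb
      by_cases haq : a = q
      · rw [haq, update_self] at ha
        rw [haq, S.mul_e_congr abs, off hkq hbq ha hb]
      · rw [update_of_ne haq] at ha
        exact off haq hbq ha hb
    by_cases hbq : b = q
    · subst hbq
      rw [update_self] at hb
      rw [S.e_symm a b, S.mul_e_congr abs, S.e_symm, half hkq ha hb]
    · rw [update_of_ne hbq] at hb
      exact half hbq ha hb

/-- Merging two blocks of the source partition. -/
theorem Reach.e_mul {r' : Setoid X} {i j : X} (hr : r ≤ r') (hij : r' i j)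
    (hmin : ∀ t : Setoid X, r ≤ t → t i j → r' ≤ t) {f : X → Quotient r} {m : N}
    (H : S.Reach r f m) : S.Reach r' (Setoid.map_of_le hr ∘ f) (S.e i j * m) := by
  induction H with
  | base =>
    have h₁ : S.E r' * (S.e i j * S.E r) = S.e i j * S.E r := by
      refine S.E_mul_of_absorbed fun a b hab => ?_
      refine hmin (S.leftAbsorbed _) (fun a b hab => ?_) ?_ hab
      · rw [leftAbsorbed_iff, ← mul_assoc, S.e_comm, mul_assoc, S.e_mul_E hab]
      · rw [leftAbsorbed_iff, ← mul_assoc, S.e_idem]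
    have h₂ : S.E r' * (S.e i j * S.E r) = S.E r' := by
      rw [← mul_assoc, S.E_absorbs r' (Quotient.sound hij), S.mul_E_of_absorbs]
      intro a b hab
      exact S.E_absorbs r' (Quotient.sound (hr (Quotient.exact hab)))
    rw [← h₁, h₂]
    exact Reach.base
  | perm π H ih =>
    rw [← mul_assoc, ← comp_assoc]
    exact ih.perm π
  | @move f m a b c H hab hne hc ih =>
    rw [← mul_assoc, comp_update]
    have hab' : (Setoid.map_of_le hr ∘ f) a = (Setoid.map_of_le hr ∘ f) b :=
      congrArg (Setoid.map_of_le hr) hab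
    by_cases hc' : (Setoid.map_of_le hr ∘ f) a = (Setoid.map_of_le hr ∘ f) c
    · rw [S.mul_z_of_absorbed (nodup_of_labels hab hne hc) (ih.absorbs hab') (ih.absorbs hc')]
      rw [← comp_apply (f := Setoid.map_of_le hr), ← hc', hab', update_eq_self]
      exact ih
    · exact ih.move hab' hne hc'

theorem Reach.exists_mul_e {f : X → Quotient r} {m : N} (H : S.Reach r f m) (a b : X) :
    ∃ (r' : Setoid X) (f' : X → Quotient r'), S.Reach r' f' (m * S.e a b) ∧ f' a = f' b := by
  obtain ⟨i, hi⟩ := Quotient.mk_surjective (f a)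
  obtain ⟨j, hj⟩ := Quotient.mk_surjective (f b)
  obtain ⟨r', hr, hij, hmin⟩ := exists_merge r i j
  refine ⟨r', Setoid.map_of_le hr ∘ f, ?_, ?_⟩
  · rw [H.mul_e hi.symm hj.symm]
    exact H.e_mul hr hij hmin
  · rw [comp_apply, comp_apply, ← hi, ← hj]
    exact Quotient.sound hij

/-- A submonoid generated by permutations and the transport `x` consists of reachable elements. -/
theorem exists_reach_of_mem_closure (S : MoveSystem X N) {a b c : X} (h : [a, b, c].Nodup) {m : N}
    (hm : m ∈ Submonoid.closure
      (Set.range S.ρ ∪ {S.z a b c * S.ρ (Equiv.swap a c)})) :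
    ∃ (r : Setoid X) (f : X → Quotient r), S.Reach r f m := by
  induction hm using Submonoid.closure_induction_right with
  | one =>
    exact ⟨⊥, _, S.E_bot ▸ Reach.base⟩
  | mul_right m _ g hg ih =>
    obtain ⟨r, f, H⟩ := ih
    rcases hg with ⟨π, rfl⟩ | rfl
    · exact ⟨r, _, H.perm π⟩
    · obtain ⟨r', f', H', hf'⟩ := H.exists_mul_e a b
      rw [← S.e_mul_z h, mul_assoc, ← mul_assoc, ← mul_assoc]
      by_cases hc : f' a = f' c
      · rw [S.mul_z_of_absorbed h (H'.absorbs hf') (H'.absorbs hc)]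
        exact ⟨r', _, H'.perm _⟩
      · exact ⟨r', _, (H'.move hf' (by simp at h; tauto) hc).perm _⟩

end Reachability

end MoveSystem

namespace CoxeterA

variable {Q : Type*} [Monoid Q]

/-- The Coxeter relations of type `A` for the first `n` members of a sequence. -/
structure IsCoxeter (g : ℕ → Q) (n : ℕ) : Prop where
  sq (i : ℕ) : i < n → g i * g i = 1
  braid (i : ℕ) : i + 1 < n → g i * g (i + 1) * g i = g (i + 1) * g i * g (i + 1)
  far (i j : ℕ) : i + 1 < j → j < n → g i * g j = g j * g i

/-- The descending product of `d` consecutive members of a sequence, starting from index `k`. -/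
def descProd (g : ℕ → Q) (k : ℕ) : ℕ → Q
  | 0 => 1
  | d + 1 => descProd g k d * g (k - d)

variable {g : ℕ → Q} {n : ℕ}

theorem IsCoxeter.mul_descProd (hg : IsCoxeter g n) {i k d : ℕ} (hd : i + d < k) (hk : k < n) :
    g i * descProd g k d = descProd g k d * g i := by
  induction d with
  | zero => simp [descProd]
  | succ d ih =>
    rw [descProd, ← mul_assoc, ih (by omega), mul_assoc, hg.far i (k - d) (by omega) (by omega),
      mul_assoc]

theorem IsCoxeter.descProd_mul (hg : IsCoxeter g n) {i k d : ℕ} (hd : k < i + d) (hdk : d ≤ k + 1)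
    (hi : i + 1 ≤ k) (hk : k < n) : descProd g k d * g (i + 1) = g i * descProd g k d := by
  induction d with
  | zero => omega
  | succ d ih =>
    by_cases h : k < i + d
    · rw [descProd, mul_assoc, hg.far (k - d) (i + 1) (by omega) (by omega), ← mul_assoc,
        ih h (by omega), mul_assoc]
    · obtain ⟨d, rfl⟩ : ∃ d', d = d' + 1 := ⟨d - 1, by omega⟩
      have h₁ : k - d = i + 1 := by omega
      have h₂ : k - (d + 1) = i := by omega
      rw [descProd, descProd, h₁, h₂]
      have := hg.braid i (by omega)
      rw [mul_assoc, mul_assoc, ← mul_assoc (g (i + 1)), ← this, ← mul_assoc, ← mul_assoc,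
        ← hg.mul_descProd (by omega) hk]
      simp only [mul_assoc]

theorem IsCoxeter.exists_descProd (hg : IsCoxeter g n) {k : ℕ} (hk : k < n) {w : Q}
    (hw : w ∈ Submonoid.closure (g '' Set.Iio (k + 1))) :
    ∃ u ∈ Submonoid.closure (g '' Set.Iio k), ∃ d ≤ k + 1, w = u * descProd g k d := by
  induction hw using Submonoid.closure_induction_right with
  | one => exact ⟨1, one_mem _, 0, by omega, by simp [descProd]⟩
  | mul_right w _ y hy ih =>
    obtain ⟨u, hu, d, hd, rfl⟩ := ih
    obtain ⟨i, hi, rfl⟩ := hy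
    rw [Set.mem_Iio] at hi
    have mem : ∀ {j}, j < k → u * g j ∈ Submonoid.closure (g '' Set.Iio k) := fun {j} hj =>
      mul_mem hu (Submonoid.subset_closure ⟨j, hj, rfl⟩)
    rcases lt_trichotomy (i + d) k with h | h | h
    · exact ⟨u * g i, mem (by omega), d, hd, by
        rw [mul_assoc, ← hg.mul_descProd h hk, mul_assoc]⟩
    · refine ⟨u, hu, d + 1, by omega, ?_⟩
      rw [descProd, show k - d = i by omega, mul_assoc]
    · by_cases h' : i + d = k + 1
      · obtain ⟨d, rfl⟩ : ∃ d', d = d' + 1 := ⟨d - 1, by omega⟩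
        refine ⟨u, hu, d, by omega, ?_⟩
        rw [descProd, show k - d = i by omega, mul_assoc, mul_assoc, hg.sq i (by omega), mul_one]
      · obtain ⟨i, rfl⟩ : ∃ i', i = i' + 1 := ⟨i - 1, by omega⟩
        exact ⟨u * g i, mem (by omega), d, hd, by
          rw [mul_assoc, hg.descProd_mul (by omega) hd (by omega) hk, mul_assoc]⟩

theorem isCoxeter_swap (n : ℕ) : IsCoxeter (fun i => Equiv.swap i (i + 1)) n where
  sq i _ := Equiv.swap_mul_self _ _
  braid i _ := by
    have h := Equiv.swap_mul_swap_mul_swap (x := i + 2) (y := i + 1) (z := i) (by omega) (by omega)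
    have h' := Equiv.swap_mul_swap_mul_swap (x := i) (y := i + 1) (z := i + 2) (by omega)
      (by omega)
    rw [Equiv.swap_comm (i + 1) i, Equiv.swap_comm (i + 2)] at h
    rw [h, Equiv.swap_comm, ← h']
  far i j _ _ := by
    refine (Equiv.Perm.disjoint_swap_swap ?_).commute.eq
    simp
    omega

variable {N : Type*} [Monoid N] {t : ℕ → N}

/-- The adjacent transpositions of `ℕ` paired with a given sequence. -/
def swapPair (t : ℕ → N) (i : ℕ) : Equiv.Perm ℕ × N := (Equiv.swap i (i + 1), t i)

theorem IsCoxeter.swapPair (ht : IsCoxeter t n) : IsCoxeter (swapPair t) n where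
  sq i hi := Prod.ext ((isCoxeter_swap n).sq i hi) (ht.sq i hi)
  braid i hi := Prod.ext ((isCoxeter_swap n).braid i hi) (ht.braid i hi)
  far i j hi hj := Prod.ext ((isCoxeter_swap n).far i j hi hj) (ht.far i j hi hj)

theorem fst_apply_of_mem_closure {k : ℕ} {u : Equiv.Perm ℕ × N}
    (hu : u ∈ Submonoid.closure (swapPair t '' Set.Iio k)) {j : ℕ} (hj : k < j) : u.1 j = j := by
  induction hu using Submonoid.closure_induction_right with
  | one => rfl
  | mul_right u _ y hy ih =>
    obtain ⟨i, hi, rfl⟩ := hy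
    rw [Set.mem_Iio] at hi
    rw [Prod.fst_mul, Equiv.Perm.mul_apply, swapPair,
      Equiv.swap_apply_of_ne_of_ne (by omega) (by omega), ih]

theorem descProd_swapPair_apply {k d : ℕ} (hd : d ≤ k + 1) :
    (descProd (swapPair t) k d).1 (k + 1 - d) = k + 1 := by
  induction d with
  | zero => rfl
  | succ d ih =>
    rw [descProd, Prod.fst_mul, Equiv.Perm.mul_apply, swapPair,
      show k + 1 - (d + 1) = k - d by omega,
      Equiv.swap_apply_left, show k - d + 1 = k + 1 - d by omega, ih (by omega)]

/-- The pairs generated by the adjacent transpositions form the graph of a function. -/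
theorem IsCoxeter.eq_one_of_mem_closure (ht : IsCoxeter t n) {k : ℕ} (hk : k ≤ n)
    {u : Equiv.Perm ℕ × N} (hu : u ∈ Submonoid.closure (CoxeterA.swapPair t '' Set.Iio k))
    (h1 : u.1 = 1) : u = 1 := by
  induction k generalizing u with
  | zero => simpa using hu
  | succ k ih =>
    obtain ⟨v, hv, d, hd, rfl⟩ := ht.swapPair.exists_descProd (by omega) hu
    have h := congrArg (· (k + 1 - d)) h1
    simp only [Prod.fst_mul, Equiv.Perm.mul_apply, descProd_swapPair_apply hd,
      fst_apply_of_mem_closure hv (Nat.lt_succ_self k), Equiv.Perm.one_apply] at h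
    obtain rfl : d = 0 := by omega
    rw [descProd, mul_one] at h1 ⊢
    exact ih (by omega) hv h1

theorem exists_hom_perm_nat (n : ℕ) : ∃ V : Equiv.Perm (Fin (n + 1)) →* Equiv.Perm ℕ,
    ∀ i : Fin n, V (Equiv.swap i.castSucc i.succ) = Equiv.swap (i : ℕ) (i + 1) := by
  refine ⟨Equiv.Perm.viaEmbeddingHom Fin.valEmbedding, fun i => Equiv.ext fun j => ?_⟩
  rw [Equiv.Perm.viaEmbeddingHom_apply]
  by_cases hj : j < n + 1
  · have := Equiv.Perm.viaEmbedding_apply (Equiv.swap i.castSucc i.succ) Fin.valEmbedding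
      (⟨j, hj⟩ : Fin (n + 1))
    rw [Fin.valEmbedding_apply] at this
    rw [this, Equiv.swap_apply_def, Equiv.swap_apply_def]
    simp only [Fin.ext_iff, Fin.val_castSucc, Fin.val_succ]
    split_ifs <;> simp
  · rw [Equiv.Perm.viaEmbedding_apply_of_notMem, Equiv.swap_apply_of_ne_of_ne (by omega) (by omega)]
    rintro ⟨k, rfl⟩
    exact hj k.2

/-- The symmetric group is presented by the adjacent transpositions and the Coxeter relations. -/
theorem IsCoxeter.exists_hom (ht : IsCoxeter t n) : ∃ ρ : Equiv.Perm (Fin (n + 1)) →* N,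
    ∀ i : Fin n, ρ (Equiv.swap i.castSucc i.succ) = t i := by
  obtain ⟨V, hVs⟩ := exists_hom_perm_nat n
  set P := Submonoid.closure (CoxeterA.swapPair t '' Set.Iio n) with hP
  have hsq : ∀ i < n, CoxeterA.swapPair t i * CoxeterA.swapPair t i = 1 := ht.swapPair.sq
  have hinv : ∀ u ∈ P, ∃ v ∈ P, v * u = 1 := by
    intro u hu
    induction hu using Submonoid.closure_induction_right with
    | one => exact ⟨1, one_mem _, one_mul 1⟩
    | mul_right u _ y hy ih =>
      obtain ⟨v, hv, hvu⟩ := ih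
      obtain ⟨i, hi, rfl⟩ := hy
      refine ⟨CoxeterA.swapPair t i * v, mul_mem (Submonoid.subset_closure ⟨i, hi, rfl⟩) hv, ?_⟩
      rw [mul_assoc, ← mul_assoc v, hvu, one_mul, hsq i hi]
  have huniq : ∀ u ∈ P, ∀ v ∈ P, u.1 = v.1 → u = v := by
    intro u hu v hv huv
    obtain ⟨w, hw, hwu⟩ := hinv u hu
    obtain ⟨w', hw', hwu'⟩ := hinv w hw
    have h1 : w * v = 1 := by
      refine ht.eq_one_of_mem_closure le_rfl (mul_mem hw hv) ?_
      rw [Prod.fst_mul, ← huv, ← Prod.fst_mul, hwu, Prod.fst_one]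
    calc u = w' * w * u := by rw [hwu', one_mul]
      _ = w' * w * v := by rw [mul_assoc, mul_assoc, hwu, h1]
      _ = v := by rw [hwu', one_mul]
  have hex : ∀ π : Equiv.Perm (Fin (n + 1)), ∃ m, (V π, m) ∈ P := by
    intro π
    have hπ : π ∈ Submonoid.closure
        (Set.range fun i : Fin n => Equiv.swap i.castSucc i.succ) := by
      rw [Equiv.Perm.mclosure_swap_castSucc_succ]
      trivial
    induction hπ using Submonoid.closure_induction_right with
    | one => exact ⟨1, by rw [map_one]; exact one_mem P⟩
    | mul_right π _ y hy ih =>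
      obtain ⟨m, hm⟩ := ih
      obtain ⟨i, rfl⟩ := hy
      refine ⟨m * t i, ?_⟩
      have := mul_mem hm (Submonoid.subset_closure ⟨i, i.2, rfl⟩ : CoxeterA.swapPair t i ∈ P)
      rwa [CoxeterA.swapPair, Prod.mk_mul_mk, ← hVs, ← map_mul] at this
  choose F hF using hex
  have hFu : ∀ π m, (V π, m) ∈ P → F π = m := fun π m h =>
    congrArg Prod.snd (huniq _ (hF π) _ h rfl)
  refine ⟨{ toFun := F, map_one' := hFu _ _ ?_, map_mul' := fun π π' => hFu _ _ ?_ }, fun i => ?_⟩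
  · rw [map_one]
    exact one_mem P
  · rw [map_mul]
    exact mul_mem (hF π) (hF π')
  · refine hFu _ _ ?_
    rw [hVs]
    exact Submonoid.subset_closure ⟨i, i.2, rfl⟩

end CoxeterA

section Conjugation

variable {X N : Type*} [Monoid N]

theorem exists_perm_map_eq [Finite X] {l l' : List X} (hl : l.Nodup) (hl' : l'.Nodup)
    (h : l.length = l'.length) : ∃ π : Equiv.Perm X, l.map π = l' := by
  obtain ⟨π, hπ⟩ := Equiv.Perm.exists_extending_pair (fun i : Fin l.length => l.get i)
    (fun i => l'.get (i.cast h)) (List.nodup_iff_injective_get.1 hl)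
    ((List.nodup_iff_injective_get.1 hl').comp (Fin.cast_injective h))
  refine ⟨π, List.ext_get (by simpa using h) fun i h₁ h₂ => ?_⟩
  simpa using hπ ⟨i, by simpa using h₁⟩

/-- Conjugation by the image of a permutation. -/
def conjHom (ρ : Equiv.Perm X →* N) (π : Equiv.Perm X) : N →* N where
  toFun y := ρ π * y * ρ π⁻¹
  map_one' := by rw [mul_one, ← map_mul, mul_inv_cancel, map_one]
  map_mul' y y' := by
    have : ρ π⁻¹ * ρ π = 1 := by rw [← map_mul, inv_mul_cancel, map_one]
    calc ρ π * (y * y') * ρ π⁻¹ = ρ π * y * 1 * y' * ρ π⁻¹ := by simp only [mul_assoc, one_mul]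
      _ = _ := by rw [← this]; simp only [mul_assoc]

variable (ρ : Equiv.Perm X →* N)

theorem conjHom_apply (π : Equiv.Perm X) (y : N) : conjHom ρ π y = ρ π * y * ρ π⁻¹ := rfl

theorem conjHom_mul (π : Equiv.Perm X) (y : N) : ρ π * y = conjHom ρ π y * ρ π := by
  rw [conjHom_apply, mul_assoc, ← map_mul, inv_mul_cancel, map_one, mul_one]

theorem conjHom_swap [DecidableEq X] (π : Equiv.Perm X) (a b : X) :
    conjHom ρ π (ρ (Equiv.swap a b)) = ρ (Equiv.swap (π a) (π b)) := by
  rw [conjHom_apply, ← map_mul, ← map_mul, Equiv.swap_apply_apply]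

theorem conjHom_conjHom (π π' : Equiv.Perm X) (y : N) :
    conjHom ρ π (conjHom ρ π' y) = conjHom ρ (π * π') y := by
  rw [conjHom_apply ρ π, conjHom_apply ρ π', conjHom_apply, mul_inv_rev, map_mul, map_mul]
  simp only [mul_assoc]

theorem conjHom_eq_self {π : Equiv.Perm X} {y : N} : conjHom ρ π y = y ↔ ρ π * y = y * ρ π := by
  rw [conjHom_mul]
  refine ⟨fun h => by rw [h], fun h => ?_⟩
  have := congrArg (· * ρ π⁻¹) h
  simpa only [mul_assoc, ← map_mul, mul_inv_cancel, map_one, mul_one] using this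

open Classical in
/-- The conjugate of `y` by a permutation carrying the list `l` to `l'`. -/
noncomputable def relabel (y : N) (l l' : List X) : N :=
  if h : ∃ π : Equiv.Perm X, l.map π = l' then conjHom ρ h.choose y else 1

variable {ρ}

theorem relabel_map {y : N} {l : List X}
    (hy : ∀ π : Equiv.Perm X, l.map π = l → conjHom ρ π y = y) (π : Equiv.Perm X) :
    relabel ρ y l (l.map π) = conjHom ρ π y := by
  have h : ∃ π' : Equiv.Perm X, l.map π' = l.map π := ⟨π, rfl⟩
  rw [relabel, dif_pos h]
  have h₁ : l.map (π⁻¹ * h.choose : Equiv.Perm X) = l := by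
    rw [Equiv.Perm.coe_mul, ← List.map_map, h.choose_spec, List.map_map, ← Equiv.Perm.coe_mul]
    simp
  have := congrArg (conjHom ρ π) (hy _ h₁)
  rwa [conjHom_conjHom, mul_inv_cancel_left] at this

theorem conjHom_relabel {y : N} {l : List X}
    (hy : ∀ π : Equiv.Perm X, l.map π = l → conjHom ρ π y = y) (π : Equiv.Perm X) (l' : List X) :
    conjHom ρ π (relabel ρ y l l') = relabel ρ y l (l'.map π) := by
  by_cases h : ∃ π' : Equiv.Perm X, l.map π' = l'
  · obtain ⟨π', rfl⟩ := h
    rw [relabel_map hy, conjHom_conjHom, List.map_map, ← Equiv.Perm.coe_mul, relabel_map hy]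
  · have h' : ¬ ∃ π' : Equiv.Perm X, l.map π' = l'.map π := by
      rintro ⟨π', h'⟩
      refine h ⟨π⁻¹ * π', ?_⟩
      rw [Equiv.Perm.coe_mul, ← List.map_map, h', List.map_map, ← Equiv.Perm.coe_mul]
      simp
    rw [relabel, dif_neg h, relabel, dif_neg h', map_one]

end Conjugation

/-- Permutations and an element `x` of a monoid `N` that satisfy the relations of the block
bijection of `X` which interchanges the blocks `{p, q}` and `{r}`. -/
structure Transport (X N : Type*) [DecidableEq X] [Monoid N] where
  ρ : Equiv.Perm X →* N
  x : N
  (p q r : X)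
  nodup : [p, q, r].Nodup
  x_conj (π : Equiv.Perm X) : π p = p → π q = q → π r = r → ρ π * x = x * ρ π
  x_cube : x * x * x = x
  x_mul_swap : x * ρ (Equiv.swap p q) = x
  swap_mul_x : ρ (Equiv.swap p q) * x = x
  t_mul_swap : x * ρ (Equiv.swap q r) * x * ρ (Equiv.swap q r) = x * ρ (Equiv.swap q r) * x
  swap_mul_t : ρ (Equiv.swap q r) * (x * ρ (Equiv.swap q r) * x) = x * ρ (Equiv.swap q r) * x
  t_mul_x : x * ρ (Equiv.swap q r) * x * x = x * ρ (Equiv.swap q r) * x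
  x_mul_t : x * x * ρ (Equiv.swap q r) * x = x * ρ (Equiv.swap q r) * x
  merge_comm {t : X} : [p, q, r, t].Nodup →
    x * x * conjHom ρ (Equiv.swap p r * Equiv.swap q t) (x * x) =
      conjHom ρ (Equiv.swap p r * Equiv.swap q t) (x * x) * (x * x)
  merge_eq {t : X} : [p, q, r, t].Nodup →
    x * x * conjHom ρ (Equiv.swap p r * Equiv.swap q t) (x * x) = x * ρ (Equiv.swap q t) * x
  x_braid {t : X} : [p, q, r, t].Nodup →
    x * ρ (Equiv.swap r t) * x = ρ (Equiv.swap r t) * x * ρ (Equiv.swap r t)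

namespace Transport

variable {X N : Type*} [DecidableEq X] [Monoid N] (G : Transport X N)

theorem swap_mul_swap (a b : X) : G.ρ (Equiv.swap a b) * G.ρ (Equiv.swap a b) = 1 := by
  rw [← map_mul, Equiv.swap_mul_self, map_one]

theorem x_sq_mul_swap {t : X} (h : [G.p, G.q, G.r, t].Nodup) :
    G.ρ (Equiv.swap G.r t) * (G.x * G.x) = G.x * G.x * G.ρ (Equiv.swap G.r t) := by
  have h₁ := G.x_braid h
  have h₂ := G.swap_mul_swap G.r t
  set s := G.ρ (Equiv.swap G.r t)
  have h₃ : G.x * G.x * s * G.x = s * G.x := by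
    calc G.x * G.x * s * G.x = G.x * (G.x * s * G.x) := by simp only [mul_assoc]
      _ = G.x * (s * G.x * s) := by rw [h₁]
      _ = G.x * s * G.x * s := by simp only [mul_assoc]
      _ = s * G.x := by rw [h₁, mul_assoc, h₂, mul_one]
  have h₄ : G.x * s * G.x * G.x = G.x * s := by
    calc G.x * s * G.x * G.x = s * G.x * s * G.x := by rw [h₁]
      _ = s * (G.x * s * G.x) := by simp only [mul_assoc]
      _ = G.x * s := by rw [h₁, mul_assoc s, ← mul_assoc, h₂, one_mul]
  calc s * (G.x * G.x) = G.x * G.x * s * G.x * G.x := by rw [h₃, mul_assoc]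
    _ = G.x * (G.x * s * G.x * G.x) := by simp only [mul_assoc]
    _ = _ := by rw [h₄, mul_assoc]

theorem conjHom_x_sq (π : Equiv.Perm X) (hp : π G.p = G.p) (hq : π G.q = G.q) :
    conjHom G.ρ π (G.x * G.x) = G.x * G.x := by
  have base : ∀ π : Equiv.Perm X, π G.p = G.p → π G.q = G.q → π G.r = G.r →
      conjHom G.ρ π (G.x * G.x) = G.x * G.x := by
    intro π hp hq hr
    rw [map_mul, (conjHom_eq_self _).2 (G.x_conj π hp hq hr)]
  by_cases hr : π G.r = G.r
  · exact base π hp hq hr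
  have nd := G.nodup
  have hpr : π G.r ≠ G.p := fun h => by
    rw [← hp] at h
    have := π.injective h
    simp [this] at nd
  have hqr : π G.r ≠ G.q := fun h => by
    rw [← hq] at h
    have := π.injective h
    simp [this] at nd
  have nd' : [G.p, G.q, G.r, π G.r].Nodup := by
    simp at nd ⊢
    grind
  have h₁ := base (Equiv.swap G.r (π G.r) * π) (by
      rw [Equiv.Perm.mul_apply, hp]
      exact Equiv.swap_apply_of_ne_of_ne (by simp at nd'; tauto) hpr.symm) (by
      rw [Equiv.Perm.mul_apply, hq]
      exact Equiv.swap_apply_of_ne_of_ne (by simp at nd'; tauto) hqr.symm) (by simp)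
  have h₂ := (conjHom_eq_self _).2 (G.x_sq_mul_swap nd')
  have h₃ := congrArg (conjHom G.ρ (Equiv.swap G.r (π G.r))) h₁
  rwa [conjHom_conjHom, ← mul_assoc, Equiv.swap_mul_self, one_mul, h₂] at h₃

/-- The move of `q` from the block of `p` to the block of `r`. -/
def z₀ : N := G.x * G.ρ (Equiv.swap G.p G.r)

theorem conjHom_z₀ (π : Equiv.Perm X) (hp : π G.p = G.p) (hq : π G.q = G.q) (hr : π G.r = G.r) :
    conjHom G.ρ π G.z₀ = G.z₀ := by
  rw [z₀, map_mul, conjHom_swap, hp, hr, (conjHom_eq_self _).2 (G.x_conj π hp hq hr)]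

/-- The idempotent merging `a` and `b`. -/
noncomputable def e (a b : X) : N := relabel G.ρ (G.x * G.x) [G.p, G.q] [a, b]

/-- The move of `b` from the block of `a` to the block of `c`. -/
noncomputable def z (a b c : X) : N := relabel G.ρ G.z₀ [G.p, G.q, G.r] [a, b, c]

theorem e_map (π : Equiv.Perm X) (a b : X) : G.e (π a) (π b) = conjHom G.ρ π (G.e a b) :=
  (conjHom_relabel (fun π h => by
    simp only [List.map_cons, List.cons.injEq] at h
    exact G.conjHom_x_sq π h.1 h.2.1) π [a, b]).symm

theorem z_map (π : Equiv.Perm X) (a b c : X) :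
    G.z (π a) (π b) (π c) = conjHom G.ρ π (G.z a b c) :=
  (conjHom_relabel (fun π h => by
    simp only [List.map_cons, List.cons.injEq] at h
    exact G.conjHom_z₀ π h.1 h.2.1 h.2.2.1) π [a, b, c]).symm

theorem conjHom_one (y : N) : conjHom G.ρ 1 y = y := by
  rw [conjHom_apply, inv_one, map_one, one_mul, mul_one]

theorem e_base (π : Equiv.Perm X) {a b : X} (hp : π G.p = a) (hq : π G.q = b) :
    G.e a b = conjHom G.ρ π (G.x * G.x) := by
  subst hp hq
  exact relabel_map (fun π h => by
    simp only [List.map_cons, List.cons.injEq] at h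
    exact G.conjHom_x_sq π h.1 h.2.1) π

theorem z_base (π : Equiv.Perm X) {a b c : X} (hp : π G.p = a) (hq : π G.q = b) (hr : π G.r = c) :
    G.z a b c = conjHom G.ρ π G.z₀ := by
  subst hp hq hr
  exact relabel_map (fun π h => by
    simp only [List.map_cons, List.cons.injEq] at h
    exact G.conjHom_z₀ π h.1 h.2.1 h.2.2.1) π

theorem e_pq : G.e G.p G.q = G.x * G.x := by
  rw [G.e_base (a := G.p) (b := G.q) 1 rfl rfl, conjHom_one]

theorem z_pqr : G.z G.p G.q G.r = G.x * G.ρ (Equiv.swap G.p G.r) := by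
  rw [G.z_base (a := G.p) (b := G.q) (c := G.r) 1 rfl rfl rfl, conjHom_one, z₀]

/-- The idempotent merging `p`, `q` and `r`. -/
def t : N := G.x * G.ρ (Equiv.swap G.q G.r) * G.x

theorem t_swap_pq : G.t * G.ρ (Equiv.swap G.p G.q) = G.t := by
  rw [t, mul_assoc, G.x_mul_swap]

theorem swap_pr : Equiv.swap G.p G.r =
    Equiv.swap G.p G.q * Equiv.swap G.q G.r * Equiv.swap G.p G.q := by
  have nd := G.nodup
  simp at nd
  rw [Equiv.swap_comm G.p G.q, Equiv.swap_comm G.q G.r,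
    Equiv.swap_mul_swap_mul_swap (by tauto) (by tauto)]

theorem swap_pr_mul : Equiv.swap G.p G.r * Equiv.swap G.q G.r =
    Equiv.swap G.q G.r * Equiv.swap G.p G.q := by
  have nd := G.nodup
  simp at nd
  have := Equiv.swap_mul_swap_mul_swap (x := G.p) (y := G.q) (z := G.r) (by tauto) (by tauto)
  rw [Equiv.swap_comm G.p G.r, ← this, mul_assoc, Equiv.swap_mul_self, mul_one]

theorem t_swap_qr : G.t * G.ρ (Equiv.swap G.q G.r) = G.t := G.t_mul_swap

theorem t_swap_pr : G.t * G.ρ (Equiv.swap G.p G.r) = G.t := by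
  rw [swap_pr, map_mul, map_mul, ← mul_assoc, ← mul_assoc, t_swap_pq, t_swap_qr, t_swap_pq]

theorem t_x : G.t * G.x = G.t := G.t_mul_x

theorem e_pr : G.e G.p G.r =
    G.ρ (Equiv.swap G.q G.r) * (G.x * G.x) * G.ρ (Equiv.swap G.q G.r) := by
  have nd := G.nodup
  simp at nd
  rw [G.e_base (Equiv.swap G.q G.r) (Equiv.swap_apply_of_ne_of_ne (by tauto) (by tauto))
    (Equiv.swap_apply_left _ _), conjHom_apply, Equiv.swap_inv]

theorem e_pq_mul_e_pr : G.e G.p G.q * G.e G.p G.r = G.t := by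
  rw [e_pq, e_pr]
  calc _ = G.x * (G.x * G.ρ (Equiv.swap G.q G.r) * G.x * G.x) * G.ρ (Equiv.swap G.q G.r) := by
        simp only [mul_assoc]
    _ = G.x * G.x * G.ρ (Equiv.swap G.q G.r) * G.x * G.ρ (Equiv.swap G.q G.r) := by
        rw [G.t_mul_x]; simp only [mul_assoc]
    _ = _ := by rw [G.x_mul_t, G.t_mul_swap, t]

theorem e_pr_mul_x : G.e G.p G.r * G.x = G.t := by
  rw [e_pr]
  calc _ = G.ρ (Equiv.swap G.q G.r) * (G.x * G.x * G.ρ (Equiv.swap G.q G.r) * G.x) := by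
        simp only [mul_assoc]
    _ = _ := by rw [G.x_mul_t, G.swap_mul_t, t]

theorem e_pr_mul_e_pq : G.e G.p G.r * G.e G.p G.q = G.t := by
  rw [e_pq, ← mul_assoc, e_pr_mul_x, t_x]

theorem t_e_pr : G.t * G.e G.p G.r = G.t := by
  rw [e_pr]
  simp only [← mul_assoc]
  simp only [t_x, t_swap_qr]

theorem e_qr : G.e G.q G.r =
    G.ρ (Equiv.swap G.p G.q) * G.e G.p G.r * G.ρ (Equiv.swap G.p G.q) := by
  have nd := G.nodup
  simp at nd
  have := G.e_map (Equiv.swap G.p G.q) G.p G.r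
  rwa [Equiv.swap_apply_left, Equiv.swap_apply_of_ne_of_ne (by tauto) (by tauto), conjHom_apply,
    Equiv.swap_inv] at this

theorem t_e_qr : G.t * G.e G.q G.r = G.t := by
  rw [e_qr, ← mul_assoc, ← mul_assoc, t_swap_pq, t_e_pr, t_swap_pq]

theorem e_qp : G.e G.q G.p = G.x * G.x := by
  rw [G.e_base (Equiv.swap G.p G.q) (by simp) (by simp), conjHom_apply, Equiv.swap_inv, mul_assoc,
    mul_assoc G.x G.x, G.x_mul_swap, ← mul_assoc, G.swap_mul_x]

theorem exists_perm_two [Finite X] {a b : X} (h : a ≠ b) :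
    ∃ π : Equiv.Perm X, π G.p = a ∧ π G.q = b := by
  have nd := G.nodup
  simp at nd
  obtain ⟨π, hπ⟩ := exists_perm_map_eq (l := [G.p, G.q]) (l' := [a, b]) (by simp; tauto)
    (by simp; tauto) rfl
  exact ⟨π, by simpa using hπ⟩

theorem exists_perm_three [Finite X] {a b c : X} (h : [a, b, c].Nodup) :
    ∃ π : Equiv.Perm X, π G.p = a ∧ π G.q = b ∧ π G.r = c := by
  obtain ⟨π, hπ⟩ := exists_perm_map_eq G.nodup h rfl
  exact ⟨π, by simpa using hπ⟩

theorem exists_perm_four [Finite X] {a b c d : X} (h : [a, b, c, d].Nodup) :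
    ∃ (π : Equiv.Perm X) (t : X), [G.p, G.q, G.r, t].Nodup ∧
      π G.p = a ∧ π G.q = b ∧ π G.r = c ∧ π t = d := by
  obtain ⟨π, rfl, rfl, rfl⟩ := G.exists_perm_three (a := a) (b := b) (c := c)
    (by simp at h ⊢; tauto)
  obtain ⟨t, rfl⟩ := π.surjective d
  refine ⟨π, t, ?_, rfl, rfl, rfl, rfl⟩
  have : [G.p, G.q, G.r, t].map π = [π G.p, π G.q, π G.r, π t] := rfl
  rw [← this] at h
  exact h.of_map

theorem e_symm [Finite X] (a b : X) : G.e a b = G.e b a := by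
  by_cases hab : a = b
  · rw [hab]
  obtain ⟨π, rfl, rfl⟩ := G.exists_perm_two hab
  rw [e_map, e_map, e_pq, e_qp]

theorem z_rqp : G.z G.r G.q G.p = G.ρ (Equiv.swap G.p G.r) * G.x := by
  have nd := G.nodup
  simp at nd
  rw [G.z_base (Equiv.swap G.p G.r) (Equiv.swap_apply_left _ _)
    (Equiv.swap_apply_of_ne_of_ne (by tauto) (by tauto)) (Equiv.swap_apply_right _ _),
    conjHom_apply, z₀, Equiv.swap_inv, mul_assoc, mul_assoc, swap_mul_swap, mul_one]

theorem e_rq : G.e G.r G.q =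
    G.ρ (Equiv.swap G.p G.r) * (G.x * G.x) * G.ρ (Equiv.swap G.p G.r) := by
  have nd := G.nodup
  simp at nd
  rw [G.e_base (Equiv.swap G.p G.r) (Equiv.swap_apply_left _ _)
    (Equiv.swap_apply_of_ne_of_ne (by tauto) (by tauto)), conjHom_apply, Equiv.swap_inv]

theorem z_mul_e_rq : G.z G.p G.q G.r * G.e G.r G.q = G.z G.p G.q G.r := by
  rw [z_pqr, e_rq, mul_assoc, ← mul_assoc (G.ρ _), ← mul_assoc (G.ρ _), swap_mul_swap, one_mul,
    ← mul_assoc, ← mul_assoc, G.x_cube]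

theorem z_mul_z_rqp : G.z G.p G.q G.r * G.z G.r G.q G.p = G.x * G.x := by
  rw [z_pqr, z_rqp, mul_assoc, ← mul_assoc (G.ρ _), swap_mul_swap, one_mul]

theorem e_pr_mul_z : G.e G.p G.r * G.z G.p G.q G.r = G.t := by
  rw [z_pqr, ← mul_assoc, e_pr_mul_x, t_swap_pr]

theorem z_mul_e_pr : G.z G.p G.q G.r * G.e G.p G.r = G.t := by
  rw [z_pqr, e_pr]
  calc _ = G.x * (G.ρ (Equiv.swap G.p G.r) * G.ρ (Equiv.swap G.q G.r)) * (G.x * G.x) *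
        G.ρ (Equiv.swap G.q G.r) := by simp only [mul_assoc]
    _ = G.x * G.ρ (Equiv.swap G.q G.r) * (G.ρ (Equiv.swap G.p G.q) * G.x) * G.x *
        G.ρ (Equiv.swap G.q G.r) := by rw [← map_mul, swap_pr_mul, map_mul]; simp only [mul_assoc]
    _ = _ := by rw [G.swap_mul_x, G.t_mul_x, G.t_mul_swap, t]

theorem t_z : G.t * G.z G.p G.q G.r = G.t := by
  rw [z_pqr, ← mul_assoc, t_x, t_swap_pr]

theorem z_mul_z_triangle_base {d : X} (h : [G.p, G.q, G.r, d].Nodup) :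
    G.z G.p G.q G.r * G.z G.r G.q d = G.z G.p G.q d := by
  have h₁ := G.x_braid h
  have nd := h
  simp at nd
  have hrd : Equiv.swap G.p G.r * Equiv.swap G.r d * Equiv.swap G.p G.r = Equiv.swap G.p d := by
    rw [Equiv.swap_comm G.p G.r, Equiv.swap_comm G.r d,
      Equiv.swap_mul_swap_mul_swap (by tauto) (by tauto)]
  have hrd' : Equiv.swap G.r d * Equiv.swap G.p G.r * Equiv.swap G.r d = Equiv.swap G.p d := by
    rw [Equiv.swap_mul_swap_mul_swap (by tauto) (by tauto), Equiv.swap_comm]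
  rw [G.z_base (Equiv.swap G.p G.r * Equiv.swap G.r d) (a := G.r) (b := G.q) (c := d)
    (by grind [Equiv.Perm.mul_apply])
    (by grind [Equiv.Perm.mul_apply])
    (by grind [Equiv.Perm.mul_apply]),
    G.z_base (Equiv.swap G.r d) (a := G.p) (b := G.q) (c := d)
    (by grind [Equiv.Perm.mul_apply])
    (by grind [Equiv.Perm.mul_apply])
    (by grind [Equiv.Perm.mul_apply]), z_pqr, z₀]
  rw [conjHom_apply, conjHom_apply]
  simp only [mul_inv_rev, Equiv.swap_inv, map_mul]
  calc _ = G.x * (G.ρ (Equiv.swap G.p G.r) * G.ρ (Equiv.swap G.p G.r)) * G.ρ (Equiv.swap G.r d) *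
        G.x * (G.ρ (Equiv.swap G.p G.r) * G.ρ (Equiv.swap G.r d) * G.ρ (Equiv.swap G.p G.r)) := by
        simp only [mul_assoc]
    _ = G.x * G.ρ (Equiv.swap G.r d) * G.x * G.ρ (Equiv.swap G.p d) := by
        rw [swap_mul_swap, mul_one, ← map_mul, ← map_mul, hrd]
    _ = _ := by
        rw [← hrd', h₁, map_mul, map_mul]
        simp only [← mul_assoc]
        rw [mul_assoc _ (G.ρ (Equiv.swap G.r d)) (G.ρ (Equiv.swap G.r d)), swap_mul_swap, mul_one]

theorem e_rd {d : X} (h : [G.p, G.q, G.r, d].Nodup) :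
    G.e G.r d = conjHom G.ρ (Equiv.swap G.p G.r * Equiv.swap G.q d) (G.x * G.x) := by
  simp at h
  exact G.e_base _ (by grind [Equiv.Perm.mul_apply])
    (by grind [Equiv.Perm.mul_apply])

theorem z_mul_z_swap_base {d : X} (h : [G.p, G.q, G.r, d].Nodup) :
    G.z G.p G.q G.r * G.z G.r d G.p =
      G.e G.p G.q * G.e G.r d * G.ρ (Equiv.swap G.q d) := by
  rw [G.e_rd h, e_pq, G.merge_eq h]
  have nd := h
  simp at nd
  have hc : Equiv.swap G.p G.r * Equiv.swap G.q d = Equiv.swap G.q d * Equiv.swap G.p G.r := by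
    refine (Equiv.Perm.disjoint_swap_swap ?_).commute.eq
    simp
    tauto
  rw [G.z_base (Equiv.swap G.p G.r * Equiv.swap G.q d) (a := G.r) (b := d) (c := G.p)
    (by grind [Equiv.Perm.mul_apply])
    (by grind [Equiv.Perm.mul_apply])
    (by grind [Equiv.Perm.mul_apply]), z_pqr, z₀, conjHom_apply, mul_inv_rev,
    Equiv.swap_inv, Equiv.swap_inv, ← hc, map_mul]
  calc _ = G.x * (G.ρ (Equiv.swap G.p G.r) * G.ρ (Equiv.swap G.p G.r)) * G.ρ (Equiv.swap G.q d) *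
        G.x * (G.ρ (Equiv.swap G.p G.r) * G.ρ (Equiv.swap G.p G.r)) * G.ρ (Equiv.swap G.q d) := by
        simp only [mul_assoc]
    _ = _ := by rw [swap_mul_swap, mul_one, mul_one]

theorem e_self (a : X) : G.e a a = 1 := by
  rw [e, relabel, dif_neg]
  rintro ⟨π, hπ⟩
  have nd := G.nodup
  simp only [List.map_cons, List.cons.injEq] at hπ
  have := π.injective (hπ.1.trans hπ.2.1.symm)
  simp [this] at nd

theorem e_idem [Finite X] (a b : X) : G.e a b * G.e a b = G.e a b := by
  by_cases hab : a = b
  · rw [hab, e_self, one_mul]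
  obtain ⟨π, rfl, rfl⟩ := G.exists_perm_two hab
  rw [e_map, ← map_mul, e_pq, ← mul_assoc, G.x_cube]

theorem e_swap [Finite X] (a b : X) : G.e a b * G.ρ (Equiv.swap a b) = G.e a b := by
  by_cases hab : a = b
  · rw [hab, Equiv.swap_self, e_self, one_mul]
    exact map_one G.ρ
  obtain ⟨π, rfl, rfl⟩ := G.exists_perm_two hab
  rw [e_map, ← conjHom_swap, ← map_mul, e_pq, mul_assoc, G.x_mul_swap]

/-- The move system generated by the permutations and `x`. -/
noncomputable def moveSystem [Finite X] : MoveSystem X N where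
  ρ := G.ρ
  e := G.e
  z := G.z
  e_self := G.e_self
  e_symm := G.e_symm
  e_conj π a b := by rw [e_map, conjHom_mul]
  z_conj π a b c := by rw [z_map, conjHom_mul]
  e_idem := G.e_idem
  e_swap := G.e_swap
  e_comm_disjoint h := by
    obtain ⟨π, t, ht, rfl, rfl, rfl, rfl⟩ := G.exists_perm_four h
    simp only [e_map, ← map_mul]
    rw [e_pq, G.e_rd ht, G.merge_comm ht]
  e_comm_adjacent {a b c} h := by
    obtain ⟨π, rfl, rfl, rfl⟩ := G.exists_perm_three (a := b) (b := a) (c := c)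
      (by simp at h ⊢; tauto)
    rw [G.e_symm (π G.q)]
    simp only [e_map, ← map_mul]
    rw [e_pq_mul_e_pr, e_pr_mul_e_pq]
  e_trans {a b c} h := by
    obtain ⟨π, rfl, rfl, rfl⟩ := G.exists_perm_three (a := b) (b := a) (c := c)
      (by simp at h ⊢; tauto)
    rw [G.e_symm (π G.q) (π G.p)]
    simp only [e_map, ← map_mul]
    rw [e_pq_mul_e_pr, t_e_qr]
  e_mul_z h := by
    obtain ⟨π, rfl, rfl, rfl⟩ := G.exists_perm_three h
    simp only [e_map, z_map, ← map_mul]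
    rw [e_pq, z_pqr, ← mul_assoc, G.x_cube]
  z_mul_e h := by
    obtain ⟨π, rfl, rfl, rfl⟩ := G.exists_perm_three h
    simp only [e_map, z_map, ← map_mul]
    rw [G.e_symm, z_mul_e_rq]
  z_mul_z h := by
    obtain ⟨π, rfl, rfl, rfl⟩ := G.exists_perm_three h
    simp only [e_map, z_map, ← map_mul]
    rw [z_mul_z_rqp, e_pq]
  e_mul_e_mul_z h := by
    obtain ⟨π, rfl, rfl, rfl⟩ := G.exists_perm_three h
    simp only [e_map, z_map, ← map_mul]
    rw [e_pq_mul_e_pr, t_z]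
  z_comm_e_ends h := by
    obtain ⟨π, rfl, rfl, rfl⟩ := G.exists_perm_three h
    simp only [e_map, z_map, ← map_mul]
    rw [e_pr_mul_z, z_mul_e_pr]
  z_mul_z_triangle h := by
    obtain ⟨π, t, ht, rfl, rfl, rfl, rfl⟩ := G.exists_perm_four h
    simp only [z_map, ← map_mul]
    rw [G.z_mul_z_triangle_base ht]
  z_mul_z_swap h := by
    obtain ⟨π, t, ht, rfl, rfl, rfl, rfl⟩ := G.exists_perm_four h
    simp only [e_map, z_map, ← conjHom_swap, ← map_mul]
    rw [G.z_mul_z_swap_base ht]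

end Transport

namespace Transport

variable {X N : Type*} [DecidableEq X] [Monoid N] (G : Transport X N)

/-- The word exchanging the blocks `{p, q, r}` and `{u}`. -/
def y (u : X) : N :=
  G.ρ (Equiv.swap G.r u) * (G.x * G.ρ (Equiv.swap G.q G.r) * G.ρ (Equiv.swap G.p G.q)) *
    G.ρ (Equiv.swap G.r u) * G.ρ (Equiv.swap G.q G.r) * G.x * G.ρ (Equiv.swap G.r u)

variable [Finite X]

theorem moveSystem_z : G.moveSystem.z = G.z := rfl

theorem moveSystem_ρ : G.moveSystem.ρ = G.ρ := rfl

/-- The successive moves of `q` and `r` from the block of `p` to the block of `u`. -/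
noncomputable def doubleMove (p q r u : X) : N :=
  G.moveSystem.e p q * G.moveSystem.e p r * G.moveSystem.z p q u * G.moveSystem.z p r u

theorem doubleMove_conj (π : Equiv.Perm X) (p q r u : X) :
    G.ρ π * G.doubleMove p q r u = G.doubleMove (π p) (π q) (π r) (π u) * G.ρ π := by
  have he := G.moveSystem.e_conj π
  have hz := G.moveSystem.z_conj π
  rw [moveSystem_ρ] at he hz
  rw [doubleMove, ← mul_assoc, ← mul_assoc, ← mul_assoc, he, mul_assoc _ (G.ρ π), he, ← mul_assoc,
    mul_assoc _ (G.ρ π), hz, ← mul_assoc, mul_assoc _ (G.ρ π), hz, ← mul_assoc, doubleMove]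

theorem doubleMove_absorbs {p q r u : X} (h : [p, q, r, u].Nodup) :
    G.doubleMove p q r u * G.moveSystem.e u q = G.doubleMove p q r u ∧
      G.doubleMove p q r u * G.moveSystem.e u r = G.doubleMove p q r u := by
  set S := G.moveSystem
  simp at h
  rw [doubleMove]
  constructor
  · rw [S.e_symm u q, mul_assoc, ← S.e_comm_z (by simp; tauto) (by tauto) (by tauto), ← mul_assoc,
      mul_assoc _ (S.z p q u), S.z_mul_e (by simp; tauto)]
  · rw [S.e_symm u r, mul_assoc, S.z_mul_e (by simp; tauto)]

theorem x_eq : G.x = G.moveSystem.z G.p G.q G.r * G.ρ (Equiv.swap G.p G.r) := by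
  rw [moveSystem_z, z_pqr, mul_assoc, swap_mul_swap, mul_one]

theorem x_mul_swap_mul_swap : G.x * G.ρ (Equiv.swap G.q G.r) * G.ρ (Equiv.swap G.p G.q) =
    G.moveSystem.z G.p G.q G.r := by
  have := G.moveSystem.mul_swap_of_absorbed (G.moveSystem.z_mul_e G.nodup)
  rw [moveSystem_ρ] at this
  rw [x_eq, mul_assoc _ (G.ρ (Equiv.swap G.p G.r)) (G.ρ (Equiv.swap G.q G.r)), ← map_mul,
    swap_pr_mul, map_mul, ← mul_assoc, this, mul_assoc,
    swap_mul_swap, mul_one]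

theorem y_eq {u : X} (h : [G.p, G.q, G.r, u].Nodup) :
    G.y u = G.doubleMove G.p G.q G.r u * G.ρ (Equiv.swap G.p u) := by
  have nd := h
  simp at nd
  have hz := G.moveSystem.z_conj
  rw [moveSystem_ρ] at hz
  have h₁ : G.y u = G.moveSystem.z G.p G.q u * G.moveSystem.z G.p G.r G.q *
      (G.ρ (Equiv.swap G.q G.r) * G.ρ (Equiv.swap G.p G.r) * G.ρ (Equiv.swap G.r u)) := by
    rw [y, x_mul_swap_mul_swap, hz, Equiv.swap_apply_left,
      Equiv.swap_apply_of_ne_of_ne (by tauto) (by tauto),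
      Equiv.swap_apply_of_ne_of_ne (by tauto) (by tauto), mul_assoc _ (G.ρ (Equiv.swap G.r u))
      (G.ρ (Equiv.swap G.r u)),
      swap_mul_swap, mul_one]
    conv_lhs => rw [G.x_eq]
    rw [← mul_assoc, mul_assoc _ _ (G.moveSystem.z _ _ _), hz, Equiv.swap_apply_left,
      Equiv.swap_apply_right, Equiv.swap_apply_of_ne_of_ne (by tauto) (by tauto)]
    simp only [mul_assoc]
  have h₂ : G.moveSystem.z G.p G.q u * G.moveSystem.z G.p G.r G.q =
      G.doubleMove G.p G.q G.r u := by
    set S := G.moveSystem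
    have nd₁ : [G.p, G.q, u].Nodup := by simp; tauto
    have nd₂ : [G.p, G.r, G.q].Nodup := by simp; tauto
    have nd₃ : [G.p, G.r, u].Nodup := by simp; tauto
    calc S.z G.p G.q u * S.z G.p G.r G.q
        = S.e G.p G.q * S.e G.p G.r * S.z G.p G.q u * S.z G.p G.r G.q := by
          rw [S.e_comm, mul_assoc _ (S.e _ _), S.e_mul_z nd₁,
            S.e_comm_z nd₁ (by tauto) (by tauto), mul_assoc _ (S.e _ _), S.e_mul_z nd₂]
      _ = _ := S.mul_z_target nd₂ nd₃ (by rw [mul_assoc, S.z_mul_e nd₁])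
  obtain ⟨h₃, h₄⟩ := G.doubleMove_absorbs h
  have h₅ := G.moveSystem.mul_swap_of_absorbed h₃
  have h₆ := G.moveSystem.mul_swap_of_absorbed h₄
  have h₇ : Equiv.swap G.q G.r * Equiv.swap G.p G.r * Equiv.swap G.r u =
      Equiv.swap u G.r * Equiv.swap u G.q * Equiv.swap G.p u := by
    ext j
    grind [Equiv.Perm.mul_apply]
  rw [moveSystem_ρ] at h₅ h₆
  rw [h₁, h₂, ← map_mul, ← map_mul, h₇, map_mul, map_mul, ← mul_assoc, ← mul_assoc, h₆, h₅]

theorem exists_perm_five {a b c d k : X} (h : [a, b, c, d, k].Nodup) :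
    ∃ (π : Equiv.Perm X) (t u : X), [G.p, G.q, G.r, t, u].Nodup ∧
      π G.p = a ∧ π G.q = b ∧ π G.r = c ∧ π t = d ∧ π u = k := by
  obtain ⟨π, rfl, rfl, rfl⟩ := G.exists_perm_three (a := a) (b := b) (c := c)
    (by simp at h ⊢; tauto)
  obtain ⟨t, rfl⟩ := π.surjective d
  obtain ⟨u, rfl⟩ := π.surjective k
  refine ⟨π, t, u, ?_, rfl, rfl, rfl, rfl, rfl⟩
  have : [G.p, G.q, G.r, t, u].map π = [π G.p, π G.q, π G.r, π t, π u] := rfl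
  rw [← this] at h
  exact h.of_map

theorem braided (hG : ∀ u v, [G.p, G.q, G.r, u, v].Nodup →
    G.y u * G.ρ (Equiv.swap u v) * G.y u =
      G.ρ (Equiv.swap u v) * G.y u * G.ρ (Equiv.swap u v)) : G.moveSystem.Braided := by
  have base : ∀ u v, [G.p, G.q, G.r, u, v].Nodup →
      G.doubleMove G.p G.q G.r u * G.doubleMove u G.q G.r v = G.doubleMove G.p G.q G.r v := by
    intro u v h
    have key := congrArg (fun m => m * G.ρ (Equiv.swap u v)) (hG u v h)
    beta_reduce at key
    have nd := h
    simp at nd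
    have h₁ : ∀ θ : Equiv.Perm X, θ = Equiv.swap G.p u * Equiv.swap u v →
        G.ρ θ * G.doubleMove G.p G.q G.r u = G.doubleMove u G.q G.r v * G.ρ θ := by
      rintro θ rfl
      rw [doubleMove_conj]
      congr 2 <;> grind [Equiv.Perm.mul_apply]
    have h₂ : G.ρ (Equiv.swap u v) * G.doubleMove G.p G.q G.r u =
        G.doubleMove G.p G.q G.r v * G.ρ (Equiv.swap u v) := by
      rw [doubleMove_conj]
      congr 2 <;> grind
    have h₃ := h₁ _ rfl
    rw [map_mul] at h₃
    have h₄ : Equiv.swap G.p u * Equiv.swap u v * Equiv.swap G.p u * Equiv.swap u v =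
        Equiv.swap u v * Equiv.swap G.p u := by
      ext j
      grind [Equiv.Perm.mul_apply]
    have key' : G.doubleMove G.p G.q G.r u * G.doubleMove u G.q G.r v *
        G.ρ (Equiv.swap u v * Equiv.swap G.p u) =
        G.doubleMove G.p G.q G.r v * G.ρ (Equiv.swap u v * Equiv.swap G.p u) := by
      have hc : G.ρ (Equiv.swap u v) * G.y u * G.ρ (Equiv.swap u v) * G.ρ (Equiv.swap u v) =
          G.doubleMove G.p G.q G.r v * G.ρ (Equiv.swap u v * Equiv.swap G.p u) := by
        rw [mul_assoc _ (G.ρ (Equiv.swap u v)) (G.ρ (Equiv.swap u v)), swap_mul_swap, mul_one,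
          G.y_eq (by simp; tauto), ← mul_assoc (G.ρ _), h₂, mul_assoc, ← map_mul]
      rw [← hc, ← key, G.y_eq (by simp; tauto), ← h₄]
      simp only [map_mul]
      calc _ = G.doubleMove G.p G.q G.r u * (G.doubleMove u G.q G.r v *
            (G.ρ (Equiv.swap G.p u) * G.ρ (Equiv.swap u v))) * G.ρ (Equiv.swap G.p u) *
              G.ρ (Equiv.swap u v) := by simp only [mul_assoc]
        _ = _ := by rw [← h₃]; simp only [mul_assoc]
    have := congrArg (· * G.ρ (Equiv.swap u v * Equiv.swap G.p u)⁻¹) key'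
    simpa only [mul_assoc, ← map_mul, mul_inv_cancel, map_one, mul_one] using this
  have hbase : ∀ {a b b' c d : X}, [a, b, b', c, d].Nodup →
      G.doubleMove a b b' c * G.doubleMove c b b' d = G.doubleMove a b b' d := by
    intro a b b' c d h
    obtain ⟨π, u, v, nd, rfl, rfl, rfl, rfl, rfl⟩ := G.exists_perm_five h
    have hπ : ∀ p q r u, G.doubleMove (π p) (π q) (π r) (π u) =
        conjHom G.ρ π (G.doubleMove p q r u) := by
      intro p q r u
      rw [conjHom_apply, doubleMove_conj, mul_assoc, ← map_mul, mul_inv_cancel, map_one, mul_one]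
    simp only [hπ, ← map_mul]
    rw [base u v nd]
  intro a b b' c d h
  obtain ⟨h₁, h₂⟩ := G.doubleMove_absorbs (p := a) (q := b) (r := b') (u := c)
    (by simp at h ⊢; tauto)
  have := hbase h
  have hd : G.doubleMove c b b' d = G.moveSystem.e c b * G.moveSystem.e c b' *
      G.moveSystem.z c b d * G.moveSystem.z c b' d := rfl
  rw [hd, ← mul_assoc, ← mul_assoc, ← mul_assoc, h₁, h₂] at this
  exact this

end Transport

section Presentation

theorem mk_eq_of_rel {n : ℕ} {u v : FreeMonoid (Fin n)} (h : MRel n u v) :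
    (Mcon n).mk' u = (Mcon n).mk' v :=
  (Mcon n).eq.2 (ConGen.Rel.of _ _ h)

theorem sm_mul_self {n i : ℕ} (hi : 1 ≤ i) (hn : i ≤ n - 1) : sm n i * sm n i = 1 := by
  have := mk_eq_of_rel (MRel.r1 hi le_rfl hn)
  rwa [mExp, if_pos rfl, pow_one, map_mul, map_one] at this

theorem isCoxeter_sm (k : ℕ) : CoxeterA.IsCoxeter (fun i => sm (k + 3) (i + 1)) (k + 2) where
  sq i hi := sm_mul_self (by omega) (by omega)
  braid i hi := by
    have h := mk_eq_of_rel (MRel.r1 (n := k + 3) (i := i + 1) (j := i + 1 + 1) (by omega)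
      (by omega) (by omega))
    have h₁ := sm_mul_self (n := k + 3) (i := i + 1) (by omega) (by omega)
    have h₂ := sm_mul_self (n := k + 3) (i := i + 1 + 1) (by omega) (by omega)
    simp only [mExp, map_pow, map_mul, map_one, show ¬ i + 1 = i + 1 + 1 by omega, if_false,
      show i + 1 + 1 - (i + 1) = 1 by omega, true_or, if_true] at h
    change (sm (k + 3) (i + 1) * sm (k + 3) (i + 1 + 1)) ^ 3 = 1 at h
    generalize sm (k + 3) (i + 1) = a at *
    generalize sm (k + 3) (i + 1 + 1) = b at *
    have h' : a * b * a * (b * a * b) = 1 := by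
      rw [← h]
      simp only [pow_succ, pow_zero, one_mul, mul_assoc]
    calc a * b * a = a * b * a * (b * (a * (b * b) * a) * b) := by
          rw [h₂, mul_one, h₁, mul_one, h₂, mul_one]
      _ = a * b * a * (b * a * b) * (b * a * b) := by simp only [mul_assoc]
      _ = b * a * b := by rw [h', one_mul]
  far i j hij hj := by
    have h := mk_eq_of_rel (MRel.r1 (n := k + 3) (i := i + 1) (j := j + 1) (by omega)
      (by omega) (by omega))
    have h₁ := sm_mul_self (n := k + 3) (i := i + 1) (by omega) (by omega)
    have h₂ := sm_mul_self (n := k + 3) (i := j + 1) (by omega) (by omega)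
    simp only [mExp, map_pow, map_mul, map_one, show ¬ i + 1 = j + 1 by omega, if_false,
      show ¬ (j + 1 - (i + 1) = 1 ∨ i + 1 - (j + 1) = 1) by omega] at h
    change (sm (k + 3) (i + 1) * sm (k + 3) (j + 1)) ^ 2 = 1 at h
    generalize sm (k + 3) (i + 1) = a at *
    generalize sm (k + 3) (j + 1) = b at *
    calc a * b = a * b * (b * (a * a) * b) := by rw [h₁, mul_one, h₂, mul_one]
      _ = a * (a * b) ^ 2 * b := by rw [h₁, mul_one, h₂, h, mul_one, mul_one]
      _ = (a * a) * (b * a) * (b * b) := by simp only [pow_two, mul_assoc]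
      _ = b * a := by rw [h₁, h₂, one_mul, mul_one]

/-- The permutations in `Mₙ`. -/
noncomputable def symHom (k : ℕ) : Equiv.Perm (Fin (k + 3)) →* M (k + 3) :=
  (isCoxeter_sm k).exists_hom.choose

theorem symHom_swap {k i : ℕ} (hi : i + 1 < k + 3) :
    symHom k (Equiv.swap ⟨i, by omega⟩ ⟨i + 1, hi⟩) = sm (k + 3) (i + 1) :=
  (isCoxeter_sm k).exists_hom.choose_spec ⟨i, by omega⟩

theorem commute_xm_sm {n i : ℕ} (hi : 4 ≤ i) (hn : i ≤ n - 1) : Commute (sm n i) (xm n) := by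
  have := mk_eq_of_rel (MRel.r7 hi hn)
  rw [map_mul, map_mul] at this
  exact this.symm

theorem commute_symHom_swap {k i d : ℕ} (hi : 3 ≤ i) (hd : i + d < k + 3) :
    Commute (symHom k (Equiv.swap ⟨i, by omega⟩ ⟨i + d, hd⟩)) (xm (k + 3)) := by
  induction d with
  | zero =>
    rw [show (⟨i + 0, hd⟩ : Fin (k + 3)) = ⟨i, hd⟩ from rfl, Equiv.swap_self, ← Equiv.Perm.one_def,
      map_one]
    exact Commute.one_left _
  | succ d ih =>
    have h := ih (by omega)
    have h' := commute_xm_sm (n := k + 3) (i := i + d + 1) (by omega) (by omega)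
    rw [← symHom_swap (by omega)] at h'
    obtain rfl | hd0 := Nat.eq_zero_or_pos d
    · exact h'
    have key : Equiv.swap (⟨i, by omega⟩ : Fin (k + 3)) ⟨i + (d + 1), hd⟩ =
        Equiv.swap ⟨i + d, by omega⟩ ⟨i + d + 1, by omega⟩ *
          Equiv.swap ⟨i, by omega⟩ ⟨i + d, by omega⟩ *
          Equiv.swap ⟨i + d, by omega⟩ ⟨i + d + 1, by omega⟩ := by
      rw [Equiv.swap_mul_swap_mul_swap]
      · exact Equiv.swap_comm _ _
      · simp [Fin.ext_iff]; omega
      · simp [Fin.ext_iff]; omega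
    rw [key, map_mul, map_mul]
    exact (h'.mul_left h).mul_left h'

theorem commute_symHom {k : ℕ} (π : Equiv.Perm (Fin (k + 3))) (h₀ : π 0 = 0) (h₁ : π 1 = 1)
    (h₂ : π 2 = 2) : Commute (symHom k π) (xm (k + 3)) := by
  have hsw : ∀ a b : Fin (k + 3), 3 ≤ (a : ℕ) → 3 ≤ (b : ℕ) →
      Commute (symHom k (Equiv.swap a b)) (xm (k + 3)) := by
    have hlt : ∀ a b : Fin (k + 3), 3 ≤ (a : ℕ) → a ≤ b →
        Commute (symHom k (Equiv.swap a b)) (xm (k + 3)) := by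
      intro a b ha hab
      have : (a : ℕ) ≤ b := hab
      convert commute_symHom_swap (k := k) (i := a) (d := b - a) ha (by omega) using 4
      omega
    intro a b ha hb
    obtain h | h := le_total a b
    · exact hlt a b ha h
    · rw [Equiv.swap_comm]
      exact hlt b a hb h
  induction h : π.support.card using Nat.strong_induction_on generalizing π with
  | _ m ih =>
    by_cases h1 : π = 1
    · simp [h1]
    obtain ⟨a, ha⟩ : ∃ a, π a ≠ a := by
      by_contra! hcon
      exact h1 (Equiv.ext hcon)
    have hfix : ∀ c : Fin (k + 3), (c : ℕ) < 3 → π c = c := by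
      intro c hc
      obtain h | h | h : c = 0 ∨ c = 1 ∨ c = 2 := by
        simp only [Fin.ext_iff, Fin.val_zero, Fin.val_one, Fin.val_two]
        omega
      all_goals rw [h]; assumption
    have ha3 : 3 ≤ (a : ℕ) := by
      by_contra! hlt
      exact ha (hfix a hlt)
    have hb3 : 3 ≤ (π a : ℕ) := by
      by_contra! hlt
      exact ha (π.injective (hfix _ hlt))
    have hs : ∀ c : Fin (k + 3), (c : ℕ) < 3 → (Equiv.swap a (π a) * π) c = c := by
      intro c hc
      rw [Equiv.Perm.mul_apply, hfix c hc]
      refine Equiv.swap_apply_of_ne_of_ne ?_ ?_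
      · rintro rfl; omega
      · rintro rfl; omega
    have key := ih _ (h ▸ Equiv.Perm.card_support_swap_mul ha) (Equiv.swap a (π a) * π)
      (hs 0 (by simp)) (hs 1 (by simp)) (hs 2 (by rw [Fin.val_two]; omega)) rfl
    have := (hsw a (π a) ha3 hb3).mul_left key
    rwa [← map_mul, Equiv.swap_mul_self_mul] at this

end Presentation

section Presentation

theorem symHom_swap_zero_one (k : ℕ) : symHom k (Equiv.swap 0 1) = sm (k + 3) 1 :=
  symHom_swap (k := k) (i := 0) (by omega)

theorem symHom_swap_one_two (k : ℕ) : symHom k (Equiv.swap 1 2) = sm (k + 3) 2 := by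
  rw [← symHom_swap (k := k) (i := 1) (by omega)]
  congr 2

theorem symHom_swap_two {k : ℕ} (hk : 3 < k + 3) :
    symHom k (Equiv.swap 2 ⟨3, hk⟩) = sm (k + 3) 3 := by
  rw [← symHom_swap (k := k) (i := 2) (by omega)]
  congr 2

/-- Relations between `x` and permutations are independent of the labels of the points that `x`
fixes. -/
theorem exists_perm_conjHom {k : ℕ} {l l' : List (Fin (k + 3))} (hl : ([0, 1, 2] ++ l).Nodup)
    (hl' : ([0, 1, 2] ++ l').Nodup) (h : l.length = l'.length) :
    ∃ π : Equiv.Perm (Fin (k + 3)), π 0 = 0 ∧ π 1 = 1 ∧ π 2 = 2 ∧ l.map π = l' ∧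
      conjHom (symHom k) π (xm (k + 3)) = xm (k + 3) := by
  obtain ⟨π, hπ⟩ := exists_perm_map_eq hl hl' (by simpa using h)
  simp only [List.map_cons, List.cons_append, List.nil_append, List.cons.injEq] at hπ
  obtain ⟨h₀, h₁, h₂, h₃⟩ := hπ
  exact ⟨π, h₀, h₁, h₂, h₃, (conjHom_eq_self _).2 (commute_symHom π h₀ h₁ h₂).eq⟩

theorem val_of_nodup {k : ℕ} {t : Fin (k + 3)} (h : [0, 1, 2, t].Nodup) : 3 ≤ (t : ℕ) := by
  by_contra! hlt
  obtain rfl | rfl | rfl : t = 0 ∨ t = 1 ∨ t = 2 := by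
    simp only [Fin.ext_iff, Fin.val_zero, Fin.val_one, Fin.val_two]
    omega
  all_goals simp at h

theorem nodup_zero_one_two (k : ℕ) : [(0 : Fin (k + 3)), 1, 2].Nodup := by
  simp [Fin.ext_iff, Nat.mod_eq_of_lt (show 2 < k + 3 by omega)]

theorem nodup_zero_one_two_three {k : ℕ} (hk : 3 < k + 3) :
    [(0 : Fin (k + 3)), 1, 2, ⟨3, hk⟩].Nodup := by
  simp [Fin.ext_iff, Nat.mod_eq_of_lt (show 2 < k + 3 by omega)]

theorem map_σw {k : ℕ} (hk : 3 < k + 3) : (Mcon (k + 3)).mk' (σw (k + 3)) =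
    symHom k (Equiv.swap 0 2 * Equiv.swap 1 ⟨3, hk⟩) := by
  have nd := nodup_zero_one_two_three hk
  have : Equiv.swap (0 : Fin (k + 3)) 2 * Equiv.swap 1 ⟨3, hk⟩ =
      Equiv.swap 1 2 * Equiv.swap 2 ⟨3, hk⟩ * Equiv.swap 0 1 * Equiv.swap 1 2 := by
    generalize (⟨3, hk⟩ : Fin (k + 3)) = d at *
    generalize (0 : Fin (k + 3)) = a at *
    generalize (1 : Fin (k + 3)) = b at *
    generalize (2 : Fin (k + 3)) = c at *
    simp at nd
    ext j
    grind [Equiv.Perm.mul_apply]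
  rw [this]
  simp only [map_mul, symHom_swap_zero_one, symHom_swap_one_two, symHom_swap_two]
  rfl

/-- Transferring a relation to a point that `x` fixes. -/
theorem conjHom_merge {k : ℕ} (π : Equiv.Perm (Fin (k + 3))) (h₀ : π 0 = 0) (h₁ : π 1 = 1)
    (h₂ : π 2 = 2) (t : Fin (k + 3)) (y : M (k + 3)) :
    conjHom (symHom k) π (conjHom (symHom k) (Equiv.swap 0 2 * Equiv.swap 1 t) y) =
      conjHom (symHom k) (Equiv.swap 0 2 * Equiv.swap 1 (π t)) (conjHom (symHom k) π y) := by
  rw [conjHom_conjHom, conjHom_conjHom, ← mul_assoc, Equiv.mul_swap_eq_swap_mul π, h₀, h₂,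
    mul_assoc,
    Equiv.mul_swap_eq_swap_mul π, h₁, mul_assoc]

theorem conjHom_σ {k : ℕ} (hk : 3 < k + 3) (y : M (k + 3)) :
    conjHom (symHom k) (Equiv.swap 0 2 * Equiv.swap 1 ⟨3, hk⟩) y = σm (k + 3) * y * σm (k + 3) := by
  have nd := nodup_zero_one_two_three hk
  rw [conjHom_apply, σm, map_σw hk]
  congr 2
  rw [mul_inv_rev, Equiv.swap_inv, Equiv.swap_inv]
  generalize (⟨3, hk⟩ : Fin (k + 3)) = d at *
  generalize (0 : Fin (k + 3)) = a at *
  generalize (1 : Fin (k + 3)) = b at *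
  generalize (2 : Fin (k + 3)) = c at *
  simp at nd
  ext j
  grind [Equiv.Perm.mul_apply]

/-- The generators of `Mₙ` satisfy the relations of a transport. -/
noncomputable def transport (k : ℕ) : Transport (Fin (k + 3)) (M (k + 3)) where
  ρ := symHom k
  x := xm (k + 3)
  p := 0
  q := 1
  r := 2
  nodup := nodup_zero_one_two k
  x_conj π h₀ h₁ h₂ := (commute_symHom π h₀ h₁ h₂).eq
  x_cube := by
    have := mk_eq_of_rel (MRel.r2 (n := k + 3))
    rwa [map_pow, pow_three'] at this
  x_mul_swap := by
    rw [symHom_swap_zero_one]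
    exact mk_eq_of_rel MRel.r3a
  swap_mul_x := by
    rw [symHom_swap_zero_one]
    exact mk_eq_of_rel MRel.r3b
  t_mul_swap := by
    rw [symHom_swap_one_two]
    exact (mk_eq_of_rel MRel.r4a).symm
  swap_mul_t := by
    rw [symHom_swap_one_two, ← mul_assoc, ← mul_assoc]
    exact (mk_eq_of_rel MRel.r4b).symm
  t_mul_x := by
    rw [symHom_swap_one_two, mul_assoc _ (xm _) (xm _), ← pow_two]
    exact (mk_eq_of_rel MRel.r4c).symm
  x_mul_t := by
    rw [symHom_swap_one_two, ← pow_two]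
    exact (mk_eq_of_rel MRel.r4d).symm
  merge_comm := by
    intro t h
    have hk : 3 < k + 3 := (val_of_nodup h).trans_lt t.2
    obtain ⟨π, h₀, h₁, h₂, h₃, hx⟩ := exists_perm_conjHom (l := [⟨3, hk⟩]) (l' := [t])
      (nodup_zero_one_two_three hk) h rfl
    simp only [List.map_cons, List.map_nil, List.cons.injEq, and_true] at h₃
    have key : xm (k + 3) * xm (k + 3) * (σm (k + 3) * (xm (k + 3) * xm (k + 3)) * σm (k + 3)) =
        σm (k + 3) * (xm (k + 3) * xm (k + 3)) * σm (k + 3) * (xm (k + 3) * xm (k + 3)) := by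
      simp only [← pow_two, ← mul_assoc]
      exact mk_eq_of_rel (MRel.r5a (by omega))
    rw [← conjHom_σ hk] at key
    have := congrArg (conjHom (symHom k) π) key
    simpa only [map_mul, conjHom_merge π h₀ h₁ h₂, hx, h₃] using this
  merge_eq := by
    intro t h
    have hk : 3 < k + 3 := (val_of_nodup h).trans_lt t.2
    obtain ⟨π, h₀, h₁, h₂, h₃, hx⟩ := exists_perm_conjHom (l := [⟨3, hk⟩]) (l' := [t])
      (nodup_zero_one_two_three hk) h rfl
    simp only [List.map_cons, List.map_nil, List.cons.injEq, and_true] at h₃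
    have hsw : symHom k (Equiv.swap 1 ⟨3, hk⟩) = sm (k + 3) 2 * sm (k + 3) 3 * sm (k + 3) 2 := by
      have nd := nodup_zero_one_two_three hk
      rw [← symHom_swap_one_two, ← symHom_swap_two hk, ← map_mul, ← map_mul]
      congr 1
      generalize (⟨3, hk⟩ : Fin (k + 3)) = d at *
      generalize (1 : Fin (k + 3)) = b at *
      generalize (2 : Fin (k + 3)) = c at *
      simp at nd
      ext j
      grind [Equiv.Perm.mul_apply]
    have key : xm (k + 3) * xm (k + 3) * (σm (k + 3) * (xm (k + 3) * xm (k + 3)) * σm (k + 3)) =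
        xm (k + 3) * symHom k (Equiv.swap 1 ⟨3, hk⟩) * xm (k + 3) := by
      rw [hsw]
      simp only [← pow_two, ← mul_assoc]
      exact mk_eq_of_rel (MRel.r5b (by omega))
    rw [← conjHom_σ hk] at key
    have := congrArg (conjHom (symHom k) π) key
    simpa only [map_mul, conjHom_merge π h₀ h₁ h₂, conjHom_swap, hx, h₁, h₃] using this
  x_braid := by
    intro t h
    have hk : 3 < k + 3 := (val_of_nodup h).trans_lt t.2
    obtain ⟨π, h₀, h₁, h₂, h₃, hx⟩ := exists_perm_conjHom (l := [⟨3, hk⟩]) (l' := [t])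
      (nodup_zero_one_two_three hk) h rfl
    simp only [List.map_cons, List.map_nil, List.cons.injEq, and_true] at h₃
    have key : xm (k + 3) * symHom k (Equiv.swap 2 ⟨3, hk⟩) * xm (k + 3) =
        symHom k (Equiv.swap 2 ⟨3, hk⟩) * xm (k + 3) * symHom k (Equiv.swap 2 ⟨3, hk⟩) := by
      rw [symHom_swap_two hk]
      exact mk_eq_of_rel (MRel.r6 (i := 3) le_rfl (by omega))
    have := congrArg (conjHom (symHom k) π) key
    simp only [map_mul, conjHom_swap, hx, h₂, h₃] at this
    exact this

theorem transport_braided (k : ℕ) : (transport k).moveSystem.Braided := by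
  refine (transport k).braided fun u v h => ?_
  change [(0 : Fin (k + 3)), 1, 2, u, v].Nodup at h
  have hu : 3 ≤ (u : ℕ) := val_of_nodup (h.sublist (by simp))
  have hv : 3 ≤ (v : ℕ) := val_of_nodup (h.sublist (by simp))
  have huv : (u : ℕ) ≠ v := fun he => by
    rw [Fin.ext he] at h
    simp at h
  have hk : 4 < k + 3 := by omega
  have hk' : 3 < k + 3 := by omega
  obtain ⟨π, h₀, h₁, h₂, h₃, hx⟩ := exists_perm_conjHom
    (l := [⟨3, by omega⟩, ⟨4, hk⟩]) (l' := [u, v])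
    (by simp [Fin.ext_iff, Nat.mod_eq_of_lt (show 2 < k + 3 by omega)]) h rfl
  simp only [List.map_cons, List.map_nil, List.cons.injEq, and_true] at h₃
  obtain ⟨h₃, h₄⟩ := h₃
  have hy : (transport k).y ⟨3, hk'⟩ = (Mcon (k + 3)).mk' (yw (k + 3) 4) := by
    change symHom k (Equiv.swap 2 ⟨3, hk'⟩) * (xm (k + 3) * symHom k (Equiv.swap 1 2) *
      symHom k (Equiv.swap 0 1)) * symHom k (Equiv.swap 2 ⟨3, hk'⟩) * symHom k (Equiv.swap 1 2) *
      xm (k + 3) * symHom k (Equiv.swap 2 ⟨3, hk'⟩) = _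
    rw [symHom_swap_zero_one, symHom_swap_one_two, symHom_swap_two]
    rfl
  have hπ : conjHom (symHom k) π ((transport k).y ⟨3, hk'⟩) = (transport k).y u := by
    change conjHom (symHom k) π (symHom k (Equiv.swap 2 ⟨3, hk'⟩) * (xm (k + 3) *
      symHom k (Equiv.swap 1 2) * symHom k (Equiv.swap 0 1)) * symHom k (Equiv.swap 2 ⟨3, hk'⟩) *
      symHom k (Equiv.swap 1 2) * xm (k + 3) * symHom k (Equiv.swap 2 ⟨3, hk'⟩)) = _
    simp only [map_mul, conjHom_swap, hx, h₀, h₁, h₂, h₃]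
    rfl
  have key : (transport k).y ⟨3, hk'⟩ * symHom k (Equiv.swap ⟨3, hk'⟩ ⟨4, hk⟩) *
      (transport k).y ⟨3, hk'⟩ = symHom k (Equiv.swap ⟨3, hk'⟩ ⟨4, hk⟩) *
        (transport k).y ⟨3, hk'⟩ * symHom k (Equiv.swap ⟨3, hk'⟩ ⟨4, hk⟩) := by
    rw [hy, symHom_swap hk]
    exact mk_eq_of_rel (MRel.r6 (i := 4) (by omega) (by omega))
  have := congrArg (conjHom (symHom k) π) key
  simp only [map_mul, conjHom_swap, h₃, h₄, hπ] at this
  exact this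

theorem mem_closure (k : ℕ) (m : M (k + 3)) : m ∈ Submonoid.closure
    (Set.range (transport k).moveSystem.ρ ∪ {(transport k).moveSystem.z 0 1 2 *
      (transport k).moveSystem.ρ (Equiv.swap 0 2)}) := by
  set C := Submonoid.closure (Set.range (transport k).moveSystem.ρ ∪
    {(transport k).moveSystem.z 0 1 2 * (transport k).moveSystem.ρ (Equiv.swap 0 2)})
  obtain ⟨w, rfl⟩ := Con.mk'_surjective m
  induction w using FreeMonoid.inductionOn' with
  | one => exact one_mem _
  | of_mul i w ih =>
    rw [map_mul]
    refine mul_mem ?_ ih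
    obtain ⟨i, hi⟩ := i
    cases i with
    | zero =>
      refine Submonoid.subset_closure (Or.inr ?_)
      have : (Mcon (k + 3)).mk' (FreeMonoid.of ⟨0, hi⟩) = (transport k).x := by
        change _ = xm (k + 3)
        rw [xm, xw, dif_pos hi]
      rw [this]
      exact (transport k).x_eq
    | succ i =>
      refine Submonoid.subset_closure (Or.inl ⟨Equiv.swap ⟨i, by omega⟩ ⟨i + 1, hi⟩, ?_⟩)
      have : (Mcon (k + 3)).mk' (FreeMonoid.of ⟨i + 1, hi⟩) = sm (k + 3) (i + 1) := by
        rw [sm, sw, dif_pos hi]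
      rw [this]
      exact symHom_swap hi

theorem exists_reach_transport {k : ℕ} (m : M (k + 3)) :
    ∃ (r : Setoid (Fin (k + 3))) (f : Fin (k + 3) → Quotient r),
      (transport k).moveSystem.Reach r f m :=
  MoveSystem.exists_reach_of_mem_closure _ (nodup_zero_one_two k) (mem_closure k m)

end Presentation

/-- Partial transformations of a type, composed from left to right. -/
def PartialMap (U : Type*) := U → Option U

namespace PartialMap

variable {U : Type*}

instance : Monoid (PartialMap U) where
  one := some
  mul f g u := (f u).bind g
  one_mul _ := rfl
  mul_one f := funext fun u => Option.bind_fun_some (f u)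
  mul_assoc f g h := funext fun u => Option.bind_assoc (f u) g h

theorem one_apply (u : U) : (1 : PartialMap U) u = some u := rfl

theorem mul_apply (f g : PartialMap U) (u : U) : (f * g) u = (f u).bind g := rfl

open Classical in
/-- The restriction of a transformation to the points satisfying `P`. -/
noncomputable def restrict (P : U → Prop) (F : U → U) : PartialMap U :=
  fun u => if P u then some (F u) else none

theorem restrict_mul (P Q : U → Prop) (F G : U → U) :
    restrict P F * restrict Q G = restrict (fun u => P u ∧ Q (F u)) (fun u => G (F u)) := by
  funext u
  by_cases hP : P u <;> by_cases hQ : Q (F u) <;>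
    simp only [mul_apply, restrict, hP, hQ, if_true, if_false, and_self, and_true,
      and_false, Option.bind]

theorem restrict_congr {P Q : U → Prop} {F G : U → U} (h : ∀ u, P u ↔ Q u)
    (h' : ∀ u, P u → F u = G u) : restrict P F = restrict Q G := by
  funext u
  by_cases hP : P u
  · simp [restrict, hP, (h u).1 hP, h' u hP]
  · simp [restrict, hP, mt (h u).2 hP]

theorem one_eq_restrict : (1 : PartialMap U) = restrict (fun _ => True) id := by
  funext u
  simp [one_apply, restrict]

end PartialMap

section Action

open PartialMap

/-- The action of a permutation on sequences. -/
noncomputable def permAct : Equiv.Perm ℕ →* PartialMap (ℕ → ℕ) where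
  toFun π := restrict (fun _ => True) (fun u => u ∘ π)
  map_one' := one_eq_restrict.symm
  map_mul' π π' := by
    rw [restrict_mul]
    exact restrict_congr (by simp) fun u _ => rfl

/-- The action of `x` on sequences. -/
noncomputable def xAct : PartialMap (ℕ → ℕ) :=
  restrict (fun u => u 0 = u 1)
    (fun u j => if j = 0 then u 2 else if j = 1 then u 2 else if j = 2 then u 0 else u j)

/-- The action of `sᵢ` on sequences. -/
noncomputable def sAct (i : ℕ) : PartialMap (ℕ → ℕ) := permAct (Equiv.swap (i - 1) i)

theorem sAct_eq (i : ℕ) : sAct i = restrict (fun _ => True)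
    (fun u j => if j = i - 1 then u i else if j = i then u (i - 1) else u j) := by
  refine restrict_congr (fun _ => Iff.rfl) fun u _ => funext fun j => ?_
  simp only [Function.comp_apply, Equiv.swap_apply_def]
  split_ifs <;> rfl

/-- The action of words on sequences. -/
noncomputable def wordAct (n : ℕ) : FreeMonoid (Fin n) →* PartialMap (ℕ → ℕ) :=
  FreeMonoid.lift fun i => if (i : ℕ) = 0 then xAct else sAct i

theorem wordAct_xw {n : ℕ} (hn : 0 < n) : wordAct n (xw n) = xAct := by
  rw [xw, dif_pos hn, wordAct, FreeMonoid.lift_eval_of, if_pos rfl]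

theorem wordAct_sw {n i : ℕ} (hi : 1 ≤ i) (hn : i < n) : wordAct n (sw n i) = sAct i := by
  rw [sw, dif_pos hn, wordAct, FreeMonoid.lift_eval_of, if_neg (by simp; omega)]

theorem wordAct_lw {n i : ℕ} (hi : i + 2 < n) : wordAct n (lw n (i + 2)) =
    restrict (fun u => u 0 = u 1)
      (fun u j => if j = 0 then u 0 else if j < i + 2 then u (j + 1) else u j) := by
  induction i with
  | zero =>
    rw [lw, map_mul, map_mul, wordAct_xw (by omega), wordAct_sw (by omega) (by omega),
      wordAct_sw (by omega) (by omega), xAct, sAct_eq, sAct_eq, restrict_mul, restrict_mul]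
    refine restrict_congr (by grind) fun u hu => funext fun j => ?_
    grind
  | succ i ih =>
    rw [lw, map_mul, map_mul, map_mul, ih (by omega), wordAct_sw (by omega) (by omega),
      wordAct_sw (by omega) (by omega), sAct_eq, sAct_eq, restrict_mul, restrict_mul, restrict_mul]
    refine restrict_congr (by grind) fun u hu => funext fun j => ?_
    grind

theorem wordAct_yw {n i : ℕ} (hi : i + 3 ≤ n) : wordAct n (yw n (i + 3)) =
    restrict (fun u => ∀ j ≤ i + 1, u j = u 0)
      (fun u j => if j ≤ i + 1 then u (i + 2) else if j = i + 2 then u 0 else u j) := by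
  induction i with
  | zero =>
    rw [yw, wordAct_xw (by omega), xAct]
    refine restrict_congr (fun u => ⟨fun h j hj => ?_, fun h => (h 1 le_rfl).symm⟩)
      fun u hu => funext fun j => ?_
    · obtain rfl | rfl : j = 0 ∨ j = 1 := by omega
      · rfl
      · exact h.symm
    · grind
  | succ i ih =>
    rw [yw, map_mul, map_mul, ih (by omega), wordAct_lw (by omega),
      wordAct_sw (by omega) (by omega), sAct_eq, restrict_mul, restrict_mul]
    refine restrict_congr (fun u => ⟨fun h j hj => ?_, fun h => ?_⟩) fun u hu => funext fun j => ?_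
    · obtain ⟨⟨h₁, h₂⟩, -⟩ := h
      have := h₂ (j - 1)
      grind
    · grind
    · grind

theorem wordAct_eq_of_rel {n : ℕ} (hn : 3 ≤ n) {w w' : FreeMonoid (Fin n)} (h : MRel n w w') :
    wordAct n w = wordAct n w' := by
  have hx : wordAct n (xw n) = xAct := wordAct_xw (by omega)
  have h₁ : wordAct n (sw n 1) = sAct 1 := wordAct_sw (by omega) (by omega)
  have h₂ : wordAct n (sw n 2) = sAct 2 := wordAct_sw (by omega) (by omega)
  cases h with
  | @r1 i j hi hij hj =>
    rw [map_pow, map_mul, wordAct_sw hi (by omega), wordAct_sw (by omega) (by omega), sAct, sAct,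
      ← map_mul, ← map_pow, map_one, ← map_one permAct]
    congr 1
    rw [mExp]
    split_ifs with hij' hij''
    · rw [hij', pow_one, Equiv.swap_mul_self]
    · ext l
      simp only [pow_succ, pow_zero, one_mul, Equiv.Perm.mul_apply, Equiv.Perm.one_apply]
      grind
    · ext l
      simp only [pow_succ, pow_zero, one_mul, Equiv.Perm.mul_apply, Equiv.Perm.one_apply]
      grind
  | r2 =>
    simp only [map_mul, hx, pow_three, xAct, restrict_mul]
    refine restrict_congr (fun u => ?_) fun u hu => funext fun j => ?_ <;> grind
  | r3a =>
    simp only [map_mul, hx, h₁, xAct, sAct_eq, restrict_mul]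
    refine restrict_congr (fun u => ?_) fun u hu => funext fun j => ?_ <;> grind
  | r3b =>
    simp only [map_mul, hx, h₁, xAct, sAct_eq, restrict_mul]
    refine restrict_congr (fun u => ?_) fun u hu => funext fun j => ?_ <;> grind
  | r4a =>
    simp only [map_mul, hx, h₂, xAct, sAct_eq, restrict_mul]
    refine restrict_congr (fun u => ?_) fun u hu => funext fun j => ?_ <;> grind
  | r4b =>
    simp only [map_mul, hx, h₂, xAct, sAct_eq, restrict_mul]
    refine restrict_congr (fun u => ?_) fun u hu => funext fun j => ?_ <;> grind
  | r4c =>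
    simp only [map_mul, pow_two, hx, h₂, xAct, sAct_eq, restrict_mul]
    refine restrict_congr (fun u => ?_) fun u hu => funext fun j => ?_ <;> grind
  | r4d =>
    simp only [map_mul, pow_two, hx, h₂, xAct, sAct_eq, restrict_mul]
    refine restrict_congr (fun u => ?_) fun u hu => funext fun j => ?_ <;> grind
  | r5a h4 =>
    have h₃ : wordAct n (sw n 3) = sAct 3 := wordAct_sw (by omega) (by omega)
    simp only [σw, map_mul, pow_two, hx, h₁, h₂, h₃, xAct, sAct_eq, restrict_mul]
    refine restrict_congr (fun u => ?_) fun u hu => funext fun j => ?_ <;> grind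
  | r5b h4 =>
    have h₃ : wordAct n (sw n 3) = sAct 3 := wordAct_sw (by omega) (by omega)
    simp only [σw, map_mul, pow_two, hx, h₁, h₂, h₃, xAct, sAct_eq, restrict_mul]
    refine restrict_congr (fun u => ?_) fun u hu => funext fun j => ?_ <;> grind
  | @r6 i hi hin =>
    obtain ⟨i, rfl⟩ := Nat.exists_eq_add_of_le' hi
    simp only [map_mul, wordAct_yw (show i + 3 ≤ n by omega),
      wordAct_sw (show 1 ≤ i + 3 by omega) (show i + 3 < n by omega), sAct_eq, restrict_mul]
    refine restrict_congr (fun u => ?_) fun u hu => funext fun j => ?_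
    · grind
    · grind
  | @r7 i hi hin =>
    simp only [map_mul, hx, wordAct_sw (show 1 ≤ i by omega) (show i < n by omega), xAct, sAct_eq,
      restrict_mul]
    refine restrict_congr (fun u => ?_) fun u hu => funext fun j => ?_ <;> grind

end Action

section Counting

open PartialMap Function

/-- The action of `Mₙ` on sequences. -/
noncomputable def act (k : ℕ) : M (k + 3) →* PartialMap (ℕ → ℕ) :=
  (Mcon (k + 3)).lift (wordAct (k + 3))
    (Con.conGen_le.2 fun _ _ h => wordAct_eq_of_rel (by omega) h)

theorem act_xm (k : ℕ) : act k (xm (k + 3)) = xAct :=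
  wordAct_xw (n := k + 3) (by omega)

theorem act_sm {k i : ℕ} (hi : 1 ≤ i) (hk : i < k + 3) : act k (sm (k + 3) i) = sAct i :=
  wordAct_sw (n := k + 3) hi hk

/-- The extension of a permutation of `{0, …, n - 1}` to the natural numbers. -/
noncomputable def extendPerm (n : ℕ) : Equiv.Perm (Fin n) →* Equiv.Perm ℕ :=
  Equiv.Perm.viaEmbeddingHom Fin.valEmbedding

theorem extendPerm_apply {n : ℕ} (π : Equiv.Perm (Fin n)) (a : Fin n) :
    extendPerm n π a = π a :=
  Equiv.Perm.viaEmbedding_apply π Fin.valEmbedding a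

theorem extendPerm_apply_of_le {n j : ℕ} (π : Equiv.Perm (Fin n)) (hj : n ≤ j) :
    extendPerm n π j = j :=
  Equiv.Perm.viaEmbedding_apply_of_notMem π Fin.valEmbedding j (by
    rintro ⟨a, rfl⟩
    exact absurd a.2 (not_lt.2 hj))

theorem extendPerm_swap {n : ℕ} (a b : Fin n) :
    extendPerm n (Equiv.swap a b) = Equiv.swap (a : ℕ) b := by
  ext j
  rcases lt_or_ge j n with hj | hj
  · lift j to Fin n using hj
    rw [extendPerm_apply]
    simp only [Equiv.swap_apply_def, Fin.ext_iff]
    split_ifs <;> rfl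
  · rw [extendPerm_apply_of_le _ hj, Equiv.swap_apply_of_ne_of_ne] <;> omega

theorem act_symHom {k : ℕ} (π : Equiv.Perm (Fin (k + 3))) :
    act k (symHom k π) = permAct (extendPerm (k + 3) π) := by
  have h : (act k).comp (symHom k) = permAct.comp (extendPerm (k + 3)) := by
    refine MonoidHom.eq_of_eqOn_denseM (Equiv.Perm.mclosure_swap_castSucc_succ (k + 2)) ?_
    rintro _ ⟨i, rfl⟩
    change act k (symHom k (Equiv.swap ⟨i, by omega⟩ ⟨i + 1, by omega⟩)) =
      permAct (extendPerm (k + 3) (Equiv.swap ⟨i, by omega⟩ ⟨i + 1, by omega⟩))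
    rw [symHom_swap, act_sm (by omega) (by omega), extendPerm_swap, sAct]
    rfl
  exact DFunLike.congr_fun h π

theorem permAct_conj (π : Equiv.Perm ℕ) (P : (ℕ → ℕ) → Prop) (F : (ℕ → ℕ) → ℕ → ℕ) :
    permAct π * restrict P F * permAct π⁻¹ =
      restrict (fun u => P (u ∘ π)) (fun u => F (u ∘ π) ∘ ⇑π⁻¹) := by
  change restrict _ _ * restrict P F * restrict _ _ = _
  rw [restrict_mul, restrict_mul]
  exact restrict_congr (by simp) fun u _ => rfl

theorem act_x_sq (k : ℕ) : act k (xm (k + 3) * xm (k + 3)) = restrict (fun u => u 0 = u 1) id := by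
  rw [map_mul, act_xm, xAct, restrict_mul]
  refine restrict_congr (by grind) fun u hu => funext fun j => ?_
  rw [id]
  split_ifs <;> grind

theorem act_z₀ (k : ℕ) : act k (transport k).z₀ =
    restrict (fun u => u 0 = u 1) (fun u => update u 1 (u 2)) := by
  have h : (transport k).z₀ = xm (k + 3) * symHom k (Equiv.swap 0 2) := rfl
  rw [h, map_mul, act_xm, act_symHom, extendPerm_swap, xAct, Fin.val_zero, Fin.val_two]
  change _ * restrict _ _ = _
  rw [restrict_mul]
  refine restrict_congr (by grind) fun u hu => funext fun j => ?_
  simp only [comp_apply, Equiv.swap_apply_def, update_apply]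
  grind

theorem act_e {k : ℕ} {a b : Fin (k + 3)} (hab : a ≠ b) :
    act k ((transport k).moveSystem.e a b) = restrict (fun u => u a = u b) id := by
  obtain ⟨π, h₀, h₁⟩ := (transport k).exists_perm_two hab
  change act k ((transport k).e a b) = _
  rw [(transport k).e_base π h₀ h₁, conjHom_apply, map_mul, map_mul]
  change act k (symHom k π) * act k (xm (k + 3) * xm (k + 3)) * act k (symHom k π⁻¹) = _
  change π 0 = a at h₀
  change π 1 = b at h₁
  rw [act_symHom, act_x_sq, act_symHom, map_inv, permAct_conj]
  have e₀ := extendPerm_apply π 0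
  have e₁ := extendPerm_apply π 1
  rw [h₀, Fin.val_zero] at e₀
  rw [h₁, Fin.val_one] at e₁
  refine restrict_congr (fun u => ?_) fun u _ => funext fun j => ?_
  · rw [comp_apply, comp_apply, e₀, e₁]
  · simp

theorem act_z {k : ℕ} {a b c : Fin (k + 3)} (h : [a, b, c].Nodup) :
    act k ((transport k).moveSystem.z a b c) =
      restrict (fun u => u a = u b) (fun u => update u (b : ℕ) (u c)) := by
  obtain ⟨π, h₀, h₁, h₂⟩ := (transport k).exists_perm_three h
  rw [(transport k).moveSystem_z, (transport k).z_base π h₀ h₁ h₂, conjHom_apply, map_mul, map_mul]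
  change act k (symHom k π) * act k (transport k).z₀ * act k (symHom k π⁻¹) = _
  change π 0 = a at h₀
  change π 1 = b at h₁
  change π 2 = c at h₂
  rw [act_symHom, act_z₀, act_symHom, map_inv, permAct_conj]
  have e₀ := extendPerm_apply π 0
  have e₁ := extendPerm_apply π 1
  have e₂ := extendPerm_apply π 2
  rw [h₀, Fin.val_zero] at e₀
  rw [h₁, Fin.val_one] at e₁
  rw [h₂, Fin.val_two] at e₂
  refine restrict_congr (fun u => ?_) fun u _ => funext fun j => ?_
  · rw [comp_apply, comp_apply, e₀, e₁]
  · simp only [comp_apply, update_apply, e₂, ← e₁, Equiv.Perm.inv_eq_iff_eq]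
    simp

variable {k : ℕ} {r : Setoid (Fin (k + 3))} {f : Fin (k + 3) → Quotient r} {m : M (k + 3)}

theorem eq_of_act (H : (transport k).moveSystem.Reach r f m) {u w : ℕ → ℕ}
    (h : act k m u = some w) {a b : Fin (k + 3)} (hab : r a b) : u a = u b := by
  by_cases hne : a = b
  · rw [hne]
  rw [← H.left_absorbs hab, map_mul, act_e hne, mul_apply] at h
  by_contra hu
  rw [restrict, if_neg hu] at h
  exact Option.some_ne_none _ h.symm

theorem act_E {u : ℕ → ℕ} (hu : ∀ a b, r a b → u (a : ℕ) = u (b : ℕ)) :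
    act k ((transport k).moveSystem.E r) u = some u := by
  let C : Submonoid (M (k + 3)) :=
    { carrier := {m | act k m u = some u}
      one_mem' := by
        change act k 1 u = some u
        rw [map_one, one_apply]
      mul_mem' := by
        intro m m' h h'
        change act k (m * m') u = some u
        rw [map_mul, mul_apply, h]
        exact h' }
  change _ ∈ C
  refine C.list_prod_mem fun y hy => ?_
  obtain ⟨p, -, rfl⟩ := List.mem_map.1 hy
  split_ifs with hp
  · by_cases hne : p.1 = p.2
    · rw [hne, (transport k).moveSystem.e_self]
      exact one_mem C
    · change act k _ u = some u
      rw [act_e hne]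
      exact if_pos (hu _ _ hp)
  · exact one_mem C

theorem exists_act (H : (transport k).moveSystem.Reach r f m) {u : ℕ → ℕ}
    (hu : ∀ a b, r a b → u (a : ℕ) = u (b : ℕ)) :
    ∃ w, act k m u = some w ∧ ∀ a j : Fin (k + 3), f j = Quotient.mk r a → w j = u a := by
  induction H with
  | base => exact ⟨u, act_E hu, fun a j h => hu _ _ (Quotient.exact h)⟩
  | perm π H ih =>
    obtain ⟨w, hw, h⟩ := ih
    refine ⟨w ∘ extendPerm (k + 3) π, ?_, fun a j hj => ?_⟩
    · rw [map_mul, mul_apply, hw, (transport k).moveSystem_ρ]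
      change act k (symHom k π) w = _
      rw [act_symHom]
      exact if_pos trivial
    · rw [comp_apply, extendPerm_apply]
      exact h a _ hj
  | @move f m p q c H hpq hne hc ih =>
    obtain ⟨w, hw, h⟩ := ih
    refine ⟨update w q (w c), ?_, fun a j hj => ?_⟩
    · obtain ⟨a, ha⟩ := Quotient.exists_rep (f p)
      rw [map_mul, mul_apply, hw, act_z (MoveSystem.nodup_of_labels hpq hne hc)]
      exact if_pos ((h a p ha.symm).trans (h a q (hpq.symm.trans ha.symm)).symm)
    · rw [update_apply] at hj ⊢
      by_cases hjq : j = q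
      · rw [if_pos hjq] at hj
        rw [if_pos (congrArg _ hjq)]
        exact h a c hj
      · rw [if_neg hjq] at hj
        rw [if_neg (Fin.val_injective.ne hjq)]
        exact h a j hj

/-- A sequence whose first `n` terms distinguish exactly the blocks of `r`. -/
theorem exists_separating (r : Setoid (Fin (k + 3))) :
    ∃ u : ℕ → ℕ, ∀ a b : Fin (k + 3), r a b ↔ u a = u b := by
  refine ⟨fun j => if hj : j < k + 3 then (Quotient.mk r ⟨j, hj⟩).out else 0, fun a b => ?_⟩
  simp only [Fin.is_lt, dif_pos, Fin.eta]
  rw [← Fin.ext_iff, Quotient.out_inj, Quotient.eq]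

theorem le_of_reach {r' : Setoid (Fin (k + 3))} {f' : Fin (k + 3) → Quotient r'}
    (H : (transport k).moveSystem.Reach r f m) (H' : (transport k).moveSystem.Reach r' f' m) :
    r ≤ r' := by
  intro a b hab
  obtain ⟨u, hu⟩ := exists_separating r'
  obtain ⟨w, hw, -⟩ := exists_act H' fun a b => (hu a b).1
  exact (hu a b).2 (eq_of_act H hw hab)

theorem eq_of_reach {f' : Fin (k + 3) → Quotient r}
    (H : (transport k).moveSystem.Reach r f m) (H' : (transport k).moveSystem.Reach r f' m) :
    f = f' := by
  obtain ⟨u, hu⟩ := exists_separating r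
  obtain ⟨w, hw, h⟩ := exists_act H fun a b => (hu a b).1
  obtain ⟨w', hw', h'⟩ := exists_act H' fun a b => (hu a b).1
  obtain rfl : w = w' := Option.some_injective _ (hw.symm.trans hw')
  funext j
  obtain ⟨a, ha⟩ := Quotient.exists_rep (f j)
  obtain ⟨b, hb⟩ := Quotient.exists_rep (f' j)
  rw [← ha, ← hb]
  exact Quotient.sound ((hu a b).2 ((h a j ha.symm).symm.trans (h' b j hb.symm)))

/-- Block bijections are the surjective labellings by the blocks of a partition. -/
theorem bijective_labelling_of_equiv {X : Type*} (r : Setoid X) :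
    Bijective fun p : (s : Setoid X) × (Quotient r ≃ Quotient s) =>
      (⟨fun j => p.2.symm (Quotient.mk p.1 j), p.2.symm.surjective.comp Quotient.mk_surjective⟩ :
        {f : X → Quotient r // Surjective f}) := by
  refine ⟨?_, fun ⟨f, hf⟩ => ⟨⟨Setoid.ker f, (Setoid.quotientKerEquivOfSurjective f hf).symm⟩, rfl⟩⟩
  rintro ⟨s, β⟩ ⟨s', β'⟩ h
  have h : ∀ j, β.symm (Quotient.mk s j) = β'.symm (Quotient.mk s' j) :=
    congrFun (Subtype.ext_iff.1 h)
  obtain rfl : s = s' := by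
    ext a b
    rw [← Quotient.eq, ← β.symm.injective.eq_iff, h, h, β'.symm.injective.eq_iff, Quotient.eq]
  obtain rfl : β = β' := Equiv.symm_bijective.injective (Equiv.ext (Quotient.ind h))
  rfl

theorem bijective_labelling (k : ℕ) :
    ∃ Ψ : ((r : Setoid (Fin (k + 3))) × {f : Fin (k + 3) → Quotient r // Surjective f}) → M (k + 3),
      Bijective Ψ := by
  choose Ψ hΨ using fun p : (r : Setoid (Fin (k + 3))) ×
    {f : Fin (k + 3) → Quotient r // Surjective f} =>
      MoveSystem.exists_reach (transport k).moveSystem p.2.1 p.2.2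
  refine ⟨Ψ, fun p p' h => ?_, fun m => ?_⟩
  · obtain ⟨r, f, hf⟩ := p
    obtain ⟨r', f', hf'⟩ := p'
    have H := hΨ ⟨r, f, hf⟩
    have H' := hΨ ⟨r', f', hf'⟩
    rw [← h] at H'
    obtain rfl : r = r' := le_antisymm (le_of_reach H H') (le_of_reach H' H)
    obtain rfl : f = f' := eq_of_reach H H'
    rfl
  · obtain ⟨r, f, H⟩ := exists_reach_transport m
    exact ⟨⟨r, f, H.surjective⟩, (hΨ _).unique (transport_braided k) H⟩

end Counting

/-- For `n ≥ 3`, the monoid `Mₙ` is finite, and its cardinality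
equals the number of triples `(r, s, β)` where `r` and `s` are equivalence relations
on `{1, …, n}` and `β` is a bijection from the quotient `{1, …, n}/r` to the quotient
`{1, …, n}/s` (this count is the cardinality of the dual symmetric inverse monoid
`Iₙ*`). -/
theorem stmt16 (n : ℕ) (hn : 3 ≤ n) :
    Finite (M n) ∧
    Nat.card (M n) =
      Nat.card ((r : Setoid (Fin n)) × (s : Setoid (Fin n)) × (Quotient r ≃ Quotient s)) := by
  obtain ⟨k, rfl⟩ := Nat.exists_eq_add_of_le' hn
  obtain ⟨Ψ, hΨ⟩ := bijective_labelling k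
  have e := (Equiv.ofBijective Ψ hΨ).symm.trans
    (Equiv.sigmaCongrRight fun r => (Equiv.ofBijective _ (bijective_labelling_of_equiv r)).symm)
  have hf : Finite (M (k + 3)) := by
    have : Finite (Setoid (Fin (k + 3))) :=
      Finite.of_injective (fun r a b => r a b) fun r r' h => Setoid.ext fun a b =>
        (congrFun (congrFun h a) b).to_iff
    exact Finite.of_surjective Ψ hΨ.2
  exact ⟨hf, Nat.card_congr e⟩
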